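/- arXiv:1801.07223 — 5 statements merged into one kernel-verified Lean document; each statement's English description precedes it below -/
import Mathlib

section
/- Let n₁, n₂ > 0 with n₁ ≠ n₂. Let x, m, w, ν₁, ν₂ be unit vectors in ℝ³ with x·ν₁ > 0, m·ν₂ > 0, (n₂/n₁)² − 1 + (x·ν₁)² ≥ 0 and (n₁/n₂)² − 1 + (m·ν₂)² ≥ 0, and suppose the Snell refraction relations x − (n₂/n₁) m = Φ_{n₂/n₁}(x·ν₁) ν₁ and m − (n₁/n₂) w = Φ_{n₁/n₂}(m·ν₂) ν₂ hold. Then w = x if and only if ν₁ = ν₂. -/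
/-!
STATEMENT 0: Snell law at two surfaces: the exit direction equals the incident
direction if and only if the two normals coincide.
`Phi κ s = s - √(κ² - 1 + s²)` is the factor in the vector form of the Snell law.
-/

noncomputable section
open scoped RealInnerProductSpace

abbrev E3 := EuclideanSpace ℝ (Fin 3)

/-- `Φ_κ(s) = s - √(κ² - 1 + s²)`. -/
def Phi (κ s : ℝ) : ℝ := s - Real.sqrt (κ ^ 2 - 1 + s ^ 2)

theorem Phi_mul_add_sqrt {κ s : ℝ} (h : 0 ≤ κ ^ 2 - 1 + s ^ 2) :
    Phi κ s * (s + Real.sqrt (κ ^ 2 - 1 + s ^ 2)) = 1 - κ ^ 2 := by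
  unfold Phi
  linear_combination -(Real.sq_sqrt h)

theorem Phi_pos_iff {κ s : ℝ} (hκ : 0 < κ) (hs : 0 < s) (h : 0 ≤ κ ^ 2 - 1 + s ^ 2) :
    0 < Phi κ s ↔ κ < 1 := by
  have hpos : 0 < s + Real.sqrt (κ ^ 2 - 1 + s ^ 2) := by positivity
  rw [← mul_pos_iff_of_pos_right hpos, Phi_mul_add_sqrt h, sub_pos,
    sq_lt_one_iff₀ hκ.le]

theorem Phi_neg_iff {κ s : ℝ} (hκ : 0 < κ) (hs : 0 < s) (h : 0 ≤ κ ^ 2 - 1 + s ^ 2) :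
    Phi κ s < 0 ↔ 1 < κ := by
  have hpos : 0 < s + Real.sqrt (κ ^ 2 - 1 + s ^ 2) := by positivity
  rw [← mul_lt_mul_iff_left₀ hpos, zero_mul, Phi_mul_add_sqrt h, sub_neg,
    one_lt_sq_iff₀ hκ.le]

/-- Unit vectors whose multiples by factors of the same sign coincide are equal. -/
theorem eq_of_smul_eq_smul_of_norm_eq_one {E : Type*} [NormedAddCommGroup E] [NormedSpace ℝ E]
    {a b : ℝ} {u v : E} (hu : ‖u‖ = 1) (hv : ‖v‖ = 1) (hab : 0 < a * b)
    (h : a • u = b • v) : u = v := by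
  have habs : |a| = |b| := by simpa [norm_smul, hu, hv] using congrArg norm h
  have ha : a ≠ 0 := left_ne_zero_of_mul hab.ne'
  rcases abs_eq_abs.1 habs with rfl | rfl
  · exact smul_right_injective E ha h
  · nlinarith [sq_nonneg b]

/-- Factors of the Snell law for the index ratio `κ` and for the reverse ratio `κ⁻¹`
have opposite signs. -/
theorem Phi_mul_neg_Phi_inv_pos {κ s t : ℝ} (hκ : 0 < κ) (hκ1 : κ ≠ 1) (hs : 0 < s) (ht : 0 < t)
    (h : 0 ≤ κ ^ 2 - 1 + s ^ 2) (h' : 0 ≤ κ⁻¹ ^ 2 - 1 + t ^ 2) :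
    0 < Phi κ s * (-(κ * Phi κ⁻¹ t)) := by
  rcases hκ1.lt_or_gt with hlt | hgt
  · have h₁ := (Phi_pos_iff hκ hs h).2 hlt
    have h₂ := (Phi_neg_iff (inv_pos.2 hκ) ht h').2 ((one_lt_inv₀ hκ).2 hlt)
    exact mul_pos h₁ (neg_pos.2 (mul_neg_of_pos_of_neg hκ h₂))
  · have h₁ := (Phi_neg_iff hκ hs h).2 hgt
    have h₂ := (Phi_pos_iff (inv_pos.2 hκ) ht h').2 (inv_lt_one_of_one_lt₀ hgt)
    exact mul_pos_of_neg_of_neg h₁ (neg_neg_of_pos (mul_pos hκ h₂))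

/-- Refraction from incidence cosine `s` to refraction cosine `t`, followed by refraction with the
reverse index ratio at a parallel surface: the two Snell displacements cancel. -/
theorem mul_Phi_inv_eq_neg_Phi {κ s t : ℝ} (hκ : 0 < κ) (hs : 0 < s)
    (h : 0 ≤ κ ^ 2 - 1 + s ^ 2) (ht : s - κ * t = Phi κ s) :
    κ * Phi κ⁻¹ t = -Phi κ s := by
  have hsqrt : κ * t = Real.sqrt (κ ^ 2 - 1 + s ^ 2) := by
    unfold Phi at ht
    linarith
  have hsq : κ ^ 2 * t ^ 2 = κ ^ 2 - 1 + s ^ 2 := by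
    rw [← mul_pow, hsqrt, Real.sq_sqrt h]
  have hroot : Real.sqrt (κ⁻¹ ^ 2 - 1 + t ^ 2) = s / κ := by
    rw [show κ⁻¹ ^ 2 - 1 + t ^ 2 = (s / κ) ^ 2 by
      field_simp
      linarith]
    exact Real.sqrt_sq (by positivity)
  rw [← ht, Phi, hroot]
  field_simp
  ring

theorem exit_direction_eq_iff_normals_eq
    (n₁ n₂ : ℝ) (hn₁ : 0 < n₁) (hn₂ : 0 < n₂) (hne : n₁ ≠ n₂)
    (x m w ν₁ ν₂ : E3)
    (hx : ‖x‖ = 1) (hm : ‖m‖ = 1) (hw : ‖w‖ = 1)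
    (hν₁ : ‖ν₁‖ = 1) (hν₂ : ‖ν₂‖ = 1)
    (hxν : 0 < ⟪x, ν₁⟫) (hmν : 0 < ⟪m, ν₂⟫)
    (hsq₁ : 0 ≤ (n₂ / n₁) ^ 2 - 1 + ⟪x, ν₁⟫ ^ 2)
    (hsq₂ : 0 ≤ (n₁ / n₂) ^ 2 - 1 + ⟪m, ν₂⟫ ^ 2)
    (hSnell₁ : x - (n₂ / n₁) • m = Phi (n₂ / n₁) ⟪x, ν₁⟫ • ν₁)
    (hSnell₂ : m - (n₁ / n₂) • w = Phi (n₁ / n₂) ⟪m, ν₂⟫ • ν₂) :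
    w = x ↔ ν₁ = ν₂ := by
  have hκ : 0 < n₂ / n₁ := div_pos hn₂ hn₁
  have hκ1 : n₂ / n₁ ≠ 1 := fun h => hne ((div_eq_one_iff_eq hn₁.ne').1 h).symm
  rw [← inv_div n₂ n₁] at hsq₂ hSnell₂
  generalize n₂ / n₁ = κ at *
  have hscaled : κ • m - w = (κ * Phi κ⁻¹ ⟪m, ν₂⟫) • ν₂ := by
    rw [mul_smul, ← hSnell₂, smul_sub, smul_inv_smul₀ hκ.ne']
  constructor
  · rintro rfl
    refine eq_of_smul_eq_smul_of_norm_eq_one hν₁ hν₂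
      (Phi_mul_neg_Phi_inv_pos hκ hκ1 hxν hmν hsq₁ hsq₂) ?_
    rw [neg_smul, ← hSnell₁, ← hscaled, neg_sub]
  · rintro rfl
    have ht : ⟪x, ν₁⟫ - κ * ⟪m, ν₁⟫ = Phi κ ⟪x, ν₁⟫ := by
      simpa [inner_sub_left, real_inner_smul_left, hν₁] using congrArg (fun v => ⟪v, ν₁⟫) hSnell₁
    rw [mul_Phi_inv_eq_neg_Phi hκ hxν hsq₁ ht, neg_smul, ← hSnell₁, neg_sub] at hscaled
    exact sub_right_injective hscaled
end
end

section
/- Let n_b > n_r > 1 and let x, ν be unit vectors in ℝ³. For n ∈ {n_r, n_b} set m_n = (1/n)(x − Φ_n(x·ν) ν). Then |m_b − m_r| ≤ (|n_b − n_r|/(n_b n_r)) · (2 + (n_b + n_r)/(n_r √(n_b² − 1) + n_b √(n_r² − 1))). -/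
/-!
STATEMENT 5: quantitative estimate for the difference of the two refracted
directions of a dichromatic ray.
-/

noncomputable section
open scoped RealInnerProductSpace

/-- Refracted direction `m_n = (1/n)(x - Φ_n(x·ν) ν)`. -/
def refracted (n : ℝ) (x ν : E3) : E3 := (1 / n) • (x - Phi n ⟪x, ν⟫ • ν)

/-- The rationalised difference of the two square roots occurring in the Snell law. -/
lemma abs_mul_sqrt_sub_mul_sqrt_le {a b t : ℝ} (ha : 1 < a) (hab : a < b) (ht : t ^ 2 ≤ 1) :
    |a * Real.sqrt (b ^ 2 - 1 + t ^ 2) - b * Real.sqrt (a ^ 2 - 1 + t ^ 2)| ≤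
      (b - a) * ((b + a) / (a * Real.sqrt (b ^ 2 - 1) + b * Real.sqrt (a ^ 2 - 1))) := by
  have ha' : 0 < a ^ 2 - 1 := by nlinarith
  have hb' : 0 < b ^ 2 - 1 := by nlinarith
  have hA : Real.sqrt (a ^ 2 - 1) ≤ Real.sqrt (a ^ 2 - 1 + t ^ 2) :=
    Real.sqrt_le_sqrt (by nlinarith [sq_nonneg t])
  have hB : Real.sqrt (b ^ 2 - 1) ≤ Real.sqrt (b ^ 2 - 1 + t ^ 2) :=
    Real.sqrt_le_sqrt (by nlinarith [sq_nonneg t])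
  have hA0 := Real.sqrt_pos.2 ha'
  have hB0 := Real.sqrt_pos.2 hb'
  have hA2 := Real.sq_sqrt (show 0 ≤ a ^ 2 - 1 + t ^ 2 by positivity)
  have hB2 := Real.sq_sqrt (show 0 ≤ b ^ 2 - 1 + t ^ 2 by positivity)
  set A := Real.sqrt (a ^ 2 - 1 + t ^ 2)
  set B := Real.sqrt (b ^ 2 - 1 + t ^ 2)
  have ha0 : 0 < a := by linarith
  have hb0 : 0 < b := by linarith
  have hD : 0 < a * Real.sqrt (b ^ 2 - 1) + b * Real.sqrt (a ^ 2 - 1) := by positivity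
  have hDle : a * Real.sqrt (b ^ 2 - 1) + b * Real.sqrt (a ^ 2 - 1) ≤ a * B + b * A := by
    gcongr
  have key : (a * B - b * A) * (a * B + b * A) = (1 - t ^ 2) * ((b - a) * (b + a)) := by
    linear_combination a ^ 2 * hB2 - b ^ 2 * hA2
  have hpos : 0 < (b - a) * (b + a) := mul_pos (by linarith) (by linarith)
  have hnn : 0 ≤ a * B - b * A :=
    nonneg_of_mul_nonneg_left (key ▸ mul_nonneg (by linarith) hpos.le) (hD.trans_le hDle)
  rw [abs_of_nonneg hnn, ← mul_div_assoc, le_div_iff₀ hD]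
  calc _ ≤ (a * B - b * A) * (a * B + b * A) := by gcongr
    _ = (1 - t ^ 2) * ((b - a) * (b + a)) := key
    _ ≤ (b - a) * (b + a) := by nlinarith [sq_nonneg t]

theorem refracted_difference_estimate
    (n_r n_b : ℝ) (hr : 1 < n_r) (hrb : n_r < n_b)
    (x ν : E3) (hx : ‖x‖ = 1) (hν : ‖ν‖ = 1) :
    ‖refracted n_b x ν - refracted n_r x ν‖ ≤
      |n_b - n_r| / (n_b * n_r) *
        (2 + (n_b + n_r) /
          (n_r * Real.sqrt (n_b ^ 2 - 1) + n_b * Real.sqrt (n_r ^ 2 - 1))) := by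
  have ha0 : 0 < n_r := by linarith
  have hb0 : 0 < n_b := by linarith
  have hba : 0 < n_b - n_r := by linarith
  have ht : |⟪x, ν⟫| ≤ 1 := by simpa [hx, hν] using abs_real_inner_le_norm x ν
  have hc := abs_mul_sqrt_sub_mul_sqrt_le hr hrb ((sq_le_one_iff_abs_le_one _).2 ht)
  unfold refracted Phi
  set t := ⟪x, ν⟫
  set A := Real.sqrt (n_r ^ 2 - 1 + t ^ 2)
  set B := Real.sqrt (n_b ^ 2 - 1 + t ^ 2)
  have hdiff : (1 / n_b) • (x - (t - B) • ν) - (1 / n_r) • (x - (t - A) • ν) =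
      (1 / (n_b * n_r)) •
        ((n_b - n_r) • (t • ν - x) + (n_r * B - n_b * A) • ν) := by
    match_scalars <;> field_simp <;> ring
  have hproj : ‖t • ν - x‖ ≤ 2 := by
    calc _ ≤ ‖t • ν‖ + ‖x‖ := norm_sub_le _ _
      _ ≤ 2 := by rw [norm_smul, hν, hx, Real.norm_eq_abs]; linarith
  rw [hdiff, norm_smul, Real.norm_of_nonneg (by positivity), abs_of_pos hba,
    div_mul_eq_mul_div, div_mul_eq_mul_div, one_mul]
  gcongr
  calc _ ≤ ‖(n_b - n_r) • (t • ν - x)‖ + ‖(n_r * B - n_b * A) • ν‖ := norm_add_le _ _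
    _ = (n_b - n_r) * ‖t • ν - x‖ + |n_r * B - n_b * A| := by
      rw [norm_smul, norm_smul, hν, mul_one, Real.norm_of_nonneg hba.le, Real.norm_eq_abs]
    _ ≤ _ := by rw [mul_add]; gcongr
end
end

section
/- In the functional differential setup, assume: (H1) P = H(0; 0, 0; P, P) and |p₁| ≤ 1; (H2) there is Λ > 0 with ‖H(t̄; ζ⁰, ζ¹; ξ⁰, ξ¹) − H(t; ζ⁰, ζ¹; ξ⁰, ξ¹)‖ ≤ Λ|t̄ − t| whenever both arguments lie in N_ε(𝒫); (H3) there are L₀, L₁ ≥ 0 with ‖H(t; ζ̄⁰, ζ̄¹; ξ⁰, ξ¹) − H(t; ζ⁰, ζ¹; ξ⁰, ξ¹)‖ ≤ L₀‖ζ̄⁰ − ζ⁰‖ + L₁‖ζ̄¹ − ζ¹‖ on N_ε(𝒫); (H4) there are C₀, C₁ ≥ 0 with C₀ + C₁ < 1 and ‖H(t; ζ⁰, ζ¹; ξ̄⁰, ξ̄¹) − H(t; ζ⁰, ζ¹; ξ⁰, ξ¹)‖ ≤ C₀‖ξ̄⁰ − ξ⁰‖ + C₁‖ξ̄¹ − ξ¹‖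 on N_ε(𝒫); (H5) |h₁(X)| ≤ 1 for all X ∈ N_ε(𝒫). Then there exist δ > 0 and a C¹ map Z = (z₁,…,zₙ) : [−δ, δ] → ℝⁿ with Z(0) = 0, Z'(0) = P, |z₁(t)| ≤ |t|, V_Z(t) ∈ N_ε(𝒫), and Z'(t) = H(t; Z(t), Z(z₁(t)); Z'(t), Z'(z₁(t))) for all |t| ≤ δ. -/
/-!
Functional differential setup (Rogers-type existence theorem): `ℝⁿ` is
`Fin n → ℝ` with an arbitrary norm `N`, the right-hand side is
`H : ℝ × (ℝⁿ)⁴ → ℝⁿ`, and `N_ε(𝒫)` is the `N`-neighborhood of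
`𝒫 = (0; 0, 0; P, P)`.
-/

noncomputable section
open Set

/-- The space `ℝ × ℝⁿ × ℝⁿ × ℝⁿ × ℝⁿ` of arguments of `H`. -/
abbrev Arg (n : ℕ) :=
  ℝ × (Fin n → ℝ) × (Fin n → ℝ) × (Fin n → ℝ) × (Fin n → ℝ)

/-- The neighborhood `N_ε(𝒫)` of `𝒫 = (0; 0, 0; P, P)` determined by a norm `N` on `ℝⁿ`:
all `(t; ζ⁰, ζ¹; ξ⁰, ξ¹)` with `|t| + N ζ⁰ + N ζ¹ + N (ξ⁰ - P) + N (ξ¹ - P) ≤ ε`. -/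
def nbhd {n : ℕ} (N : (Fin n → ℝ) → ℝ) (P : Fin n → ℝ) (ε : ℝ) : Set (Arg n) :=
  {p | |p.1| + N p.2.1 + N p.2.2.1 + N (p.2.2.2.1 - P) + N (p.2.2.2.2 - P) ≤ ε}

open scoped BoundedContinuousFunction

/-- The retraction of the real line onto `[-δ, δ]`. -/
def clamp (δ t : ℝ) : ℝ := max (-δ) (min t δ)

lemma abs_clamp_le {δ : ℝ} (hδ : 0 ≤ δ) (t : ℝ) : |clamp δ t| ≤ δ :=
  abs_le.2 ⟨le_max_left _ _, max_le (by linarith) (min_le_right _ _)⟩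

lemma clamp_of_mem {δ t : ℝ} (ht : t ∈ Icc (-δ) δ) : clamp δ t = t := by
  rw [clamp, min_eq_left ht.2, max_eq_right ht.1]

lemma abs_clamp_sub_le (δ t s : ℝ) : |clamp δ t - clamp δ s| ≤ |t - s| := by
  rw [clamp, clamp, max_comm, max_comm (-δ)]
  refine (abs_max_sub_max_le_abs _ _ _).trans ?_
  simpa using abs_min_sub_min_le_max t δ s δ

section Integral

variable {E : Type*} [NormedAddCommGroup E] [NormedSpace ℝ E]

lemma integral_sub_integral {w : ℝ → E} (hw : Continuous w) (t s : ℝ) :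
    (∫ x in (0 : ℝ)..t, w x) - ∫ x in (0 : ℝ)..s, w x = ∫ x in s..t, w x :=
  intervalIntegral.integral_interval_sub_left (hw.intervalIntegrable _ _)
    (hw.intervalIntegrable _ _)

lemma norm_integral_sub_integral_le {w : ℝ → E} (hw : Continuous w) {B : ℝ}
    (hB : ∀ x, ‖w x‖ ≤ B) (t s : ℝ) :
    ‖(∫ x in (0 : ℝ)..t, w x) - ∫ x in (0 : ℝ)..s, w x‖ ≤ B * |t - s| := by
  rw [integral_sub_integral hw]
  exact intervalIntegral.norm_integral_le_of_norm_le_const fun x _ => hB x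

lemma norm_integral_le {w : ℝ → E} {B : ℝ} (hB : ∀ x, ‖w x‖ ≤ B) (t : ℝ) :
    ‖∫ x in (0 : ℝ)..t, w x‖ ≤ B * |t| := by
  simpa using intervalIntegral.norm_integral_le_of_norm_le_const (a := 0) (b := t)
    fun x _ => hB x

lemma abs_map_integral_sub_integral_le [CompleteSpace E] (φ : E →L[ℝ] ℝ) {w : ℝ → E}
    (hw : Continuous w) (hφ : ∀ x, |φ (w x)| ≤ 1) (t s : ℝ) :
    |φ (∫ x in (0 : ℝ)..t, w x) - φ (∫ x in (0 : ℝ)..s, w x)| ≤ |t - s| := by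
  rw [← map_sub, integral_sub_integral hw,
    ← φ.intervalIntegral_comp_comm (hw.intervalIntegrable _ _), ← Real.norm_eq_abs]
  simpa using intervalIntegral.norm_integral_le_of_norm_le_const (a := s) (b := t)
    (f := fun x => φ (w x)) (C := 1) fun x _ => by simpa using hφ x

lemma norm_integral_sub_integral_le_dist (w v : ℝ →ᵇ E) (t : ℝ) :
    ‖(∫ x in (0 : ℝ)..t, w x) - ∫ x in (0 : ℝ)..t, v x‖ ≤ dist w v * |t| := by
  rw [← intervalIntegral.integral_sub (w.continuous.intervalIntegrable _ _)
    (v.continuous.intervalIntegrable _ _)]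
  exact norm_integral_le (fun x => by
    rw [← dist_eq_norm]; exact BoundedContinuousFunction.dist_coe_le_dist x) t

end Integral

section Banach

variable {E : Type*} [NormedAddCommGroup E] [NormedSpace ℝ E]

/-- The sum neighborhood of `(0; 0, 0; P, P)` of radius `ε` in `ℝ × E⁴`. -/
def InSumBall (P : E) (ε t : ℝ) (a b c d : E) : Prop :=
  |t| + ‖a‖ + ‖b‖ + ‖c - P‖ + ‖d - P‖ ≤ ε

/-- The admissible derivatives: `M`-Lipschitz functions with value `P` at `0` that stay within
`r` of `P` and whose image under `φ` has absolute value at most one. -/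
def admissible (φ : E →L[ℝ] ℝ) (P : E) (M r : ℝ) : Set (ℝ →ᵇ E) :=
  {w | w 0 = P ∧ (∀ t s, ‖w t - w s‖ ≤ M * |t - s|) ∧ (∀ t, ‖w t - P‖ ≤ r) ∧
    ∀ t, |φ (w t)| ≤ 1}

lemma isClosed_admissible (φ : E →L[ℝ] ℝ) (P : E) (M r : ℝ) :
    IsClosed (admissible φ P M r) := by
  have hev : ∀ t : ℝ, Continuous fun w : ℝ →ᵇ E => w t := fun t =>
    continuous_eval_const t
  simp only [admissible, ofPred_and, ofPred_forall]
  refine (isClosed_eq (hev 0) continuous_const).inter (IsClosed.inter ?_ (IsClosed.inter ?_ ?_))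
  · exact isClosed_iInter fun t => isClosed_iInter fun s =>
      isClosed_le ((hev t).sub (hev s)).norm continuous_const
  · exact isClosed_iInter fun t => isClosed_le ((hev t).sub continuous_const).norm continuous_const
  · exact isClosed_iInter fun t => isClosed_le (φ.continuous.comp (hev t)).abs continuous_const

/-- Local existence for a functional differential equation of neutral type with
state-dependent argument `φ (Z t)` in a Banach space. -/
theorem exists_local_solution [CompleteSpace E] (φ : E →L[ℝ] ℝ) (P : E) {ε : ℝ} (hε : 0 < ε)
    (H : ℝ → E → E → E → E → E) (hP : H 0 0 0 P P = P)
    {Λ L0 L1 C0 C1 : ℝ} (hΛ : 0 < Λ) (hL0 : 0 ≤ L0) (hL1 : 0 ≤ L1)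
    (hC0 : 0 ≤ C0) (hC1 : 0 ≤ C1) (hC : C0 + C1 < 1)
    (hLipT : ∀ t' t a b c d, InSumBall P ε t' a b c d → InSumBall P ε t a b c d →
      ‖H t' a b c d - H t a b c d‖ ≤ Λ * |t' - t|)
    (hLipZeta : ∀ t a' b' a b c d, InSumBall P ε t a' b' c d → InSumBall P ε t a b c d →
      ‖H t a' b' c d - H t a b c d‖ ≤ L0 * ‖a' - a‖ + L1 * ‖b' - b‖)
    (hLipXi : ∀ t a b c' d' c d, InSumBall P ε t a b c' d' → InSumBall P ε t a b c d →
      ‖H t a b c' d' - H t a b c d‖ ≤ C0 * ‖c' - c‖ + C1 * ‖d' - d‖)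
    (hφH : ∀ t a b c d, InSumBall P ε t a b c d → |φ (H t a b c d)| ≤ 1) :
    ∃ (δ : ℝ) (Z Z' : ℝ → E), 0 < δ ∧ (∀ t, HasDerivAt Z (Z' t) t) ∧ Continuous Z' ∧
      Z 0 = 0 ∧ Z' 0 = P ∧ ∀ t ∈ Icc (-δ) δ, |φ (Z t)| ≤ |t| ∧
        InSumBall P ε t (Z t) (Z (φ (Z t))) (Z' t) (Z' (φ (Z t))) ∧
        Z' t = H t (Z t) (Z (φ (Z t))) (Z' t) (Z' (φ (Z t))) := by
  set B : ℝ := ‖P‖ + 1 with hB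
  have hB0 : 0 < B := by positivity
  have hq : 0 < 1 - C0 - C1 := by linarith
  obtain ⟨M, hM0, hM⟩ : ∃ M : ℝ, 0 < M ∧ Λ + L0 * B + L1 * B + C0 * M + C1 * M = M := by
    refine ⟨(Λ + L0 * B + L1 * B) / (1 - C0 - C1), by positivity, ?_⟩
    field_simp
    ring
  set K : ℝ := L0 + L1 * (B * ‖φ‖ + 1) + C1 * (M * ‖φ‖) with hK
  obtain ⟨δ, hδ, hδM, hδε, hδK⟩ : ∃ δ : ℝ, 0 < δ ∧ M * δ ≤ 1 ∧
      (1 + 2 * B + 2 * M) * δ ≤ ε ∧ K * δ ≤ (1 - C0 - C1) / 2 := by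
    have h : ∀ A r : ℝ, 0 < r → ∀ᶠ δ in nhdsWithin (0 : ℝ) (Ioi 0), A * δ ≤ r := by
      intro A r hr
      have : Filter.Tendsto (fun δ : ℝ => A * δ) (nhdsWithin 0 (Ioi 0)) (nhds (A * 0)) :=
        ((continuous_const.mul continuous_id).tendsto 0).mono_left nhdsWithin_le_nhds
      rw [mul_zero] at this
      exact (this.eventually (gt_mem_nhds hr)).mono fun _ h => le_of_lt h
    obtain ⟨δ, h0, h1, h2, h3⟩ := ((eventually_mem_nhdsWithin (a := (0 : ℝ)) (s := Ioi 0)).and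
      ((h M 1 one_pos).and ((h (1 + 2 * B + 2 * M) ε hε).and
        (h K ((1 - C0 - C1) / 2) (by positivity))))).exists
    exact ⟨δ, h0, h1, h2, h3⟩
  let Box : ℝ → E → E → E → E → Prop := fun t a b c d =>
    |t| ≤ δ ∧ ‖a‖ ≤ B * δ ∧ ‖b‖ ≤ B * δ ∧ ‖c - P‖ ≤ M * δ ∧ ‖d - P‖ ≤ M * δ
  have hBox : ∀ {t a b c d}, Box t a b c d → InSumBall P ε t a b c d := by
    rintro t a b c d ⟨h1, h2, h3, h4, h5⟩
    simp only [InSumBall]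
    linarith
  have hLip : ∀ {t' a' b' c' d' t a b c d}, Box t' a' b' c' d' → Box t a b c d →
      ‖H t' a' b' c' d' - H t a b c d‖ ≤ Λ * |t' - t| + (L0 * ‖a' - a‖ + L1 * ‖b' - b‖) +
        (C0 * ‖c' - c‖ + C1 * ‖d' - d‖) := by
    rintro t' a' b' c' d' t a b c d ⟨h1', h2', h3', h4', h5'⟩ ⟨h1, h2, h3, h4, h5⟩
    have e1 := hLipT t' t a' b' c' d' (hBox ⟨h1', h2', h3', h4', h5'⟩)
      (hBox ⟨h1, h2', h3', h4', h5'⟩)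
    have e2 := hLipZeta t a' b' a b c' d' (hBox ⟨h1, h2', h3', h4', h5'⟩)
      (hBox ⟨h1, h2, h3, h4', h5'⟩)
    have e3 := hLipXi t a b c' d' c d (hBox ⟨h1, h2, h3, h4', h5'⟩)
      (hBox ⟨h1, h2, h3, h4, h5⟩)
    calc ‖H t' a' b' c' d' - H t a b c d‖
        = ‖(H t' a' b' c' d' - H t a' b' c' d') + (H t a' b' c' d' - H t a b c' d') +
            (H t a b c' d' - H t a b c d)‖ := by congr 1; abel
      _ ≤ _ := norm_add₃_le.trans (by gcongr)
  let X := admissible φ P M (M * δ)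
  let Z : (ℝ →ᵇ E) → ℝ → E := fun w t => ∫ x in (0 : ℝ)..t, w x
  have hwB : ∀ w ∈ X, ∀ t, ‖w t‖ ≤ B := by
    rintro w ⟨-, -, h, -⟩ t
    have := norm_le_norm_add_norm_sub' (w t) P
    linarith [h t]
  have hZ0 : ∀ w, Z w 0 = 0 := fun w => intervalIntegral.integral_same
  have hZlip : ∀ w ∈ X, ∀ t s, ‖Z w t - Z w s‖ ≤ B * |t - s| := fun w hw t s =>
    norm_integral_sub_integral_le w.continuous (hwB w hw) t s
  have hφlip : ∀ w ∈ X, ∀ t s, |φ (Z w t) - φ (Z w s)| ≤ |t - s| := fun w hw t s =>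
    abs_map_integral_sub_integral_le φ w.continuous hw.2.2.2 t s
  have hφle : ∀ w ∈ X, ∀ t, |φ (Z w t)| ≤ |t| := fun w hw t => by
    simpa [hZ0] using hφlip w hw t 0
  have hV : ∀ w ∈ X, ∀ t, |t| ≤ δ →
      Box t (Z w t) (Z w (φ (Z w t))) (w t) (w (φ (Z w t))) := by
    intro w hw t ht
    have hZ : ∀ s, |s| ≤ δ → ‖Z w s‖ ≤ B * δ := fun s hs =>
      (norm_integral_le (hwB w hw) s).trans (by gcongr)
    exact ⟨ht, hZ t ht, hZ _ ((hφle w hw t).trans ht), hw.2.2.1 _, hw.2.2.1 _⟩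
  let T : (ℝ →ᵇ E) → ℝ → E := fun w t =>
    H t (Z w t) (Z w (φ (Z w t))) (w t) (w (φ (Z w t)))
  have hT0 : ∀ w ∈ X, T w 0 = P := fun w hw => by
    simp only [T, hZ0, map_zero, hw.1, hP]
  have hTlip : ∀ w ∈ X, ∀ t s, |t| ≤ δ → |s| ≤ δ → ‖T w t - T w s‖ ≤ M * |t - s| := by
    intro w hw t s ht hs
    have e1 := hφlip w hw t s
    calc ‖T w t - T w s‖ ≤ _ := hLip (hV w hw t ht) (hV w hw s hs)
      _ ≤ Λ * |t - s| + (L0 * (B * |t - s|) + L1 * (B * |t - s|)) +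
          (C0 * (M * |t - s|) + C1 * (M * |t - s|)) := by
        gcongr
        · exact hZlip w hw t s
        · exact (hZlip w hw _ _).trans (by gcongr)
        · exact hw.2.1 t s
        · exact (hw.2.1 _ _).trans (by gcongr)
      _ = (Λ + L0 * B + L1 * B + C0 * M + C1 * M) * |t - s| := by ring
      _ = M * |t - s| := by rw [hM]
  have hTdist : ∀ w ∈ X, ∀ v ∈ X, ∀ t, |t| ≤ δ →
      ‖T w t - T v t‖ ≤ (1 + C0 + C1) / 2 * dist w v := by
    intro w hw v hv t ht
    have hd : 0 ≤ dist w v := dist_nonneg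
    have hZd : ∀ s, |s| ≤ δ → ‖Z w s - Z v s‖ ≤ δ * dist w v := fun s hs =>
      (norm_integral_sub_integral_le_dist w v s).trans
        (by rw [mul_comm]; gcongr)
    have hwd : ∀ s, ‖w s - v s‖ ≤ dist w v := fun s => by
      rw [← dist_eq_norm]; exact BoundedContinuousFunction.dist_coe_le_dist s
    have hφd : |φ (Z w t) - φ (Z v t)| ≤ ‖φ‖ * (δ * dist w v) := by
      rw [← map_sub, ← Real.norm_eq_abs]
      exact (φ.le_opNorm _).trans (by gcongr; exact hZd t ht)
    have hs : |φ (Z v t)| ≤ δ := (hφle v hv t).trans ht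
    have e3 : ‖Z w (φ (Z w t)) - Z v (φ (Z v t))‖ ≤
        B * (‖φ‖ * (δ * dist w v)) + δ * dist w v :=
      (norm_sub_le_norm_sub_add_norm_sub _ (Z w (φ (Z v t))) _).trans
        (add_le_add ((hZlip w hw _ _).trans (by gcongr)) (hZd _ hs))
    have e4 : ‖w (φ (Z w t)) - v (φ (Z v t))‖ ≤
        M * (‖φ‖ * (δ * dist w v)) + dist w v :=
      (norm_sub_le_norm_sub_add_norm_sub _ (w (φ (Z v t))) _).trans
        (add_le_add ((hw.2.1 _ _).trans (by gcongr)) (hwd _))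
    calc ‖T w t - T v t‖ ≤ _ := hLip (hV w hw t ht) (hV v hv t ht)
      _ ≤ Λ * |t - t| + (L0 * (δ * dist w v) +
            L1 * (B * (‖φ‖ * (δ * dist w v)) + δ * dist w v)) +
          (C0 * dist w v + C1 * (M * (‖φ‖ * (δ * dist w v)) + dist w v)) := by
        gcongr
        · exact hZd t ht
        · exact hwd t
      _ = (K * δ + C0 + C1) * dist w v := by rw [hK, sub_self, abs_zero]; ring
      _ ≤ (1 + C0 + C1) / 2 * dist w v := by gcongr; linarith
  have hex : ∀ w : X, ∃ v : X, ∀ t, (v : ℝ →ᵇ E) t = T w (clamp δ t) := by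
    rintro ⟨w, hw⟩
    have hlip : ∀ t s, ‖T w (clamp δ t) - T w (clamp δ s)‖ ≤ M * |t - s| := fun t s =>
      (hTlip w hw _ _ (abs_clamp_le hδ.le t) (abs_clamp_le hδ.le s)).trans
        (mul_le_mul_of_nonneg_left (abs_clamp_sub_le δ t s) hM0.le)
    have hz : T w (clamp δ 0) = P := by
      rw [clamp_of_mem ⟨by linarith, hδ.le⟩, hT0 w hw]
    have hnear : ∀ t, ‖T w (clamp δ t) - P‖ ≤ M * δ := fun t => by
      have := hTlip w hw (clamp δ t) 0 (abs_clamp_le hδ.le t) (by simpa using hδ.le)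
      rw [hT0 w hw, sub_zero] at this
      exact this.trans (by gcongr; exact abs_clamp_le hδ.le t)
    have hcont : Continuous fun t => T w (clamp δ t) :=
      (LipschitzWith.of_dist_le_mul (K := M.toNNReal) fun t s => by
        rw [Real.coe_toNNReal _ hM0.le, dist_eq_norm, Real.dist_eq]; exact hlip t s).continuous
    refine ⟨⟨BoundedContinuousFunction.ofNormedAddCommGroup _ hcont (‖P‖ + M * δ) fun t =>
      (norm_le_norm_add_norm_sub' _ P).trans (by gcongr; exact hnear t), ?_⟩, fun t => rfl⟩
    exact ⟨hz, hlip, hnear, fun t => hφH _ _ _ _ _ (hBox (hV w hw _ (abs_clamp_le hδ.le t)))⟩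
  choose F hF using hex
  have : CompleteSpace X := (isClosed_admissible φ P M (M * δ)).completeSpace_coe
  have : Nonempty X := by
    refine ⟨⟨BoundedContinuousFunction.const ℝ P, rfl, fun t s => ?_, fun t => ?_, fun t => ?_⟩⟩
    · simpa using by positivity
    · simpa using by positivity
    · have h : InSumBall P ε 0 0 0 P P := by simpa [InSumBall] using hε.le
      simpa [hP] using hφH _ _ _ _ _ h
  have hcontr : ContractingWith (Real.toNNReal ((1 + C0 + C1) / 2)) F := by
    refine ⟨?_, LipschitzWith.of_dist_le_mul fun w v => ?_⟩
    · rw [Real.toNNReal_lt_one]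
      linarith
    · rw [Real.coe_toNNReal _ (by positivity)]
      refine (BoundedContinuousFunction.dist_le (by positivity)).2 fun t => ?_
      rw [hF, hF, dist_eq_norm]
      exact hTdist w w.2 v v.2 _ (abs_clamp_le hδ.le t)
  obtain ⟨⟨w, hw⟩, hfix⟩ : ∃ w : X, F w = w := ⟨_, hcontr.fixedPoint_isFixedPt⟩
  refine ⟨δ, Z w, w, hδ, fun t => ?_, w.continuous, hZ0 w, hw.1, fun t ht =>
    ⟨hφle w hw t, hBox (hV w hw t (abs_le.2 ht)), ?_⟩⟩
  · exact (w.continuous.integral_hasStrictDerivAt 0 t).hasDerivAt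
  · have := hF ⟨w, hw⟩ t
    rw [hfix, clamp_of_mem ht] at this
    exact this

end Banach

/-- A copy of `ℝⁿ` that carries no norm by default. -/
def NormCopy (n : ℕ) : Type := Fin n → ℝ

instance (n : ℕ) : AddCommGroup (NormCopy n) := inferInstanceAs (AddCommGroup (Fin n → ℝ))

instance (n : ℕ) : Module ℝ (NormCopy n) := inferInstanceAs (Module ℝ (Fin n → ℝ))

instance (n : ℕ) : FiniteDimensional ℝ (NormCopy n) :=
  inferInstanceAs (FiniteDimensional ℝ (Fin n → ℝ))

/-- local existence for the system of first order functional
differential equations `Z'(t) = H(t; Z(t), Z(z₁(t)); Z'(t), Z'(z₁(t)))`,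
`Z(0) = 0`, with `Z'(0) = P`, under hypotheses (H1)-(H5). -/
theorem fde_local_existence
    (n : ℕ) (hn : 0 < n)
    (N : (Fin n → ℝ) → ℝ)
    (hN0 : ∀ x, 0 ≤ N x)
    (hNdef : ∀ x, N x = 0 ↔ x = 0)
    (hNadd : ∀ x y, N (x + y) ≤ N x + N y)
    (hNsmul : ∀ (c : ℝ) (x), N (c • x) = |c| * N x)
    (P : Fin n → ℝ) (ε : ℝ) (hε : 0 < ε)
    (H : Arg n → (Fin n → ℝ))
    (hHcont : ContinuousOn H (nbhd N P ε))
    -- (H1)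
    (hP : P = H (0, 0, 0, P, P))
    (hp1 : |P ⟨0, hn⟩| ≤ 1)
    -- (H2)
    (Λ : ℝ) (hΛ : 0 < Λ)
    (hLipT : ∀ t' t ζ0 ζ1 ξ0 ξ1,
      (t', ζ0, ζ1, ξ0, ξ1) ∈ nbhd N P ε → (t, ζ0, ζ1, ξ0, ξ1) ∈ nbhd N P ε →
      N (H (t', ζ0, ζ1, ξ0, ξ1) - H (t, ζ0, ζ1, ξ0, ξ1)) ≤ Λ * |t' - t|)
    -- (H3)
    (L0 L1 : ℝ) (hL0 : 0 ≤ L0) (hL1 : 0 ≤ L1)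
    (hLipZeta : ∀ t ζ0' ζ1' ζ0 ζ1 ξ0 ξ1,
      (t, ζ0', ζ1', ξ0, ξ1) ∈ nbhd N P ε → (t, ζ0, ζ1, ξ0, ξ1) ∈ nbhd N P ε →
      N (H (t, ζ0', ζ1', ξ0, ξ1) - H (t, ζ0, ζ1, ξ0, ξ1)) ≤
        L0 * N (ζ0' - ζ0) + L1 * N (ζ1' - ζ1))
    -- (H4)
    (C0 C1 : ℝ) (hC0 : 0 ≤ C0) (hC1 : 0 ≤ C1) (hC : C0 + C1 < 1)
    (hLipXi : ∀ t ζ0 ζ1 ξ0' ξ1' ξ0 ξ1,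
      (t, ζ0, ζ1, ξ0', ξ1') ∈ nbhd N P ε → (t, ζ0, ζ1, ξ0, ξ1) ∈ nbhd N P ε →
      N (H (t, ζ0, ζ1, ξ0', ξ1') - H (t, ζ0, ζ1, ξ0, ξ1)) ≤
        C0 * N (ξ0' - ξ0) + C1 * N (ξ1' - ξ1))
    -- (H5)
    (hH1 : ∀ p ∈ nbhd N P ε, |H p ⟨0, hn⟩| ≤ 1) :
    ∃ (δ : ℝ) (Z Z' : ℝ → Fin n → ℝ), 0 < δ ∧
      (∀ t ∈ Icc (-δ) δ, HasDerivAt Z (Z' t) t) ∧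
      ContinuousOn Z' (Icc (-δ) δ) ∧
      Z 0 = 0 ∧ Z' 0 = P ∧
      ∀ t ∈ Icc (-δ) δ,
        |Z t ⟨0, hn⟩| ≤ |t| ∧
        (t, Z t, Z (Z t ⟨0, hn⟩), Z' t, Z' (Z t ⟨0, hn⟩)) ∈ nbhd N P ε ∧
        Z' t = H (t, Z t, Z (Z t ⟨0, hn⟩), Z' t, Z' (Z t ⟨0, hn⟩)) := by
  let _ : Norm (NormCopy n) := ⟨N⟩
  have core : NormedSpace.Core ℝ (NormCopy n) :=
    { norm_nonneg := hN0
      norm_smul := hNsmul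
      norm_triangle := hNadd
      norm_eq_zero_iff := hNdef }
  let _ : NormedAddCommGroup (NormCopy n) := NormedAddCommGroup.ofCore core
  let _ : NormedSpace ℝ (NormCopy n) := NormedSpace.ofCore core
  have : CompleteSpace (NormCopy n) := FiniteDimensional.complete ℝ _
  let e : NormCopy n →L[ℝ] (Fin n → ℝ) :=
    LinearMap.toContinuousLinearMap (LinearMap.id : (Fin n → ℝ) →ₗ[ℝ] (Fin n → ℝ))
  let φ : NormCopy n →L[ℝ] ℝ := (ContinuousLinearMap.proj ⟨0, hn⟩).comp e
  obtain ⟨δ, Z, Z', hδ, hderiv, hcont, hZ0, hZ'0, hsol⟩ :=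
    exists_local_solution (E := NormCopy n) φ P hε (fun t a b c d => H (t, a, b, c, d)) hP.symm
      hΛ hL0 hL1 hC0 hC1 hC hLipT hLipZeta hLipXi (fun t a b c d h => hH1 (t, a, b, c, d) h)
  exact ⟨δ, Z, Z', hδ, fun t _ => e.hasFDerivAt.comp_hasDerivAt t (hderiv t),
    (e.continuous.comp hcont).continuousOn, hZ0, hZ'0, hsol⟩
end
end

section
/- In the functional differential setup, under hypotheses (H1)–(H5) of the local existence theorem (P = H(0;0,0;P,P), |p₁| ≤ 1, Lipschitz continuity in t with constant Λ, in (ζ⁰, ζ¹) with constants L₀, L₁, contraction in (ξ⁰, ξ¹) with constants C₀ + C₁ < 1, and |h₁| ≤ 1 on N_ε(𝒫)), the local solution with derivative P at 0 is unique: there exists δ* > 0 such that if 0 < δ₁, δ₂ ≤ δ* and, for i = 1, 2, Zⁱ : [−δᵢ, δᵢ] → ℝⁿ is C¹ with Zⁱ(0) = 0, (Zⁱ)'(0) = P, V_{Zⁱ}(t) ∈ N_ε(𝒫) and (Zⁱ)'(t) = H(V_{Zⁱ}(t)) for |t| ≤ δᵢ, then Z¹(t) = Z²(t) for all |t| ≤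 min(δ₁, δ₂). -/
/-!
Functional differential setup (Rogers-type existence theorem): `ℝⁿ` is
`Fin n → ℝ` with an arbitrary norm `N`, the right-hand side is
`H : ℝ × (ℝⁿ)⁴ → ℝⁿ`, and `N_ε(𝒫)` is the `N`-neighborhood of
`𝒫 = (0; 0, 0; P, P)`.
-/

noncomputable section
open Set

/-- `N` is a norm on `ℝⁿ`. -/
structure IsNormFun {n : ℕ} (N : (Fin n → ℝ) → ℝ) : Prop where
  nonneg : ∀ x, 0 ≤ N x
  eq_zero_iff : ∀ x, N x = 0 ↔ x = 0
  add_le : ∀ x y, N (x + y) ≤ N x + N y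
  smul : ∀ (c : ℝ) (x), N (c • x) = |c| * N x

/-- A norm on `ℝⁿ` is realised by a linear homeomorphism onto a normed space. -/
theorem exists_normed_model {V : Type} [AddCommGroup V] [Module ℝ V] {n : ℕ}
    (e₀ : (Fin n → ℝ) ≃ₗ[ℝ] V) {N : (Fin n → ℝ) → ℝ} (hN : IsNormFun N) :
    ∃ (E : Type) (_ : NormedAddCommGroup E) (_ : NormedSpace ℝ E)
      (e : (Fin n → ℝ) ≃L[ℝ] E), ∀ x, ‖e x‖ = N x := by
  let : Norm V := ⟨fun x => N (e₀.symm x)⟩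
  have core : NormedSpace.Core ℝ V :=
    { norm_nonneg := fun x => hN.nonneg _
      norm_smul := fun c x => by
        change N (e₀.symm (c • x)) = _ * N (e₀.symm x)
        rw [map_smul, hN.smul, Real.norm_eq_abs]
      norm_triangle := fun x y => by
        change N (e₀.symm (x + y)) ≤ N (e₀.symm x) + N (e₀.symm y)
        rw [map_add]
        exact hN.add_le _ _
      norm_eq_zero_iff := fun x => by
        change N (e₀.symm x) = 0 ↔ x = 0
        rw [hN.eq_zero_iff, map_eq_zero_iff _ e₀.symm.injective] }
  let : NormedAddCommGroup V := NormedAddCommGroup.ofCore core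
  let : NormedSpace ℝ V := NormedSpace.ofCore core
  refine ⟨V, inferInstance, inferInstance, e₀.toContinuousLinearEquiv, fun x => ?_⟩
  change N (e₀.symm (e₀ x)) = N x
  rw [e₀.symm_apply_apply]

namespace IsNormFun

variable {n : ℕ} {N : (Fin n → ℝ) → ℝ}

theorem map_zero (hN : IsNormFun N) : N 0 = 0 := (hN.eq_zero_iff 0).2 rfl

theorem sub_le (hN : IsNormFun N) (x y z : Fin n → ℝ) : N (x - z) ≤ N (x - y) + N (y - z) := by
  simpa using hN.add_le (x - y) (y - z)

theorem sub_comm (hN : IsNormFun N) (x y : Fin n → ℝ) : N (x - y) = N (y - x) := by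
  simpa using hN.smul (-1) (y - x)

/-- The mean value inequality with respect to an arbitrary norm. -/
theorem image_sub_le (hN : IsNormFun N) {δ B : ℝ} {f f' : ℝ → Fin n → ℝ}
    (hf : ∀ t ∈ Icc (-δ) δ, HasDerivAt f (f' t) t) (hB : ∀ t ∈ Icc (-δ) δ, N (f' t) ≤ B)
    {s t : ℝ} (hs : s ∈ Icc (-δ) δ) (ht : t ∈ Icc (-δ) δ) : N (f t - f s) ≤ B * |t - s| := by
  obtain ⟨E, _, _, e, he⟩ := exists_normed_model (LinearEquiv.refl ℝ _) hN
  have key := Convex.norm_image_sub_le_of_norm_hasDerivWithin_le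
    (f := fun x => e (f x)) (f' := fun x => e (f' x)) (C := B)
    (fun x hx => ((e : (Fin n → ℝ) →L[ℝ] E).hasFDerivAt.comp_hasDerivAt x
      (hf x hx)).hasDerivWithinAt) (fun x hx => by rw [he]; exact hB x hx)
    (convex_Icc (-δ) δ) hs ht
  rwa [← map_sub, he, Real.norm_eq_abs] at key

/-- Coordinates are bounded by any norm. -/
theorem exists_abs_apply_le (hN : IsNormFun N) :
    ∃ κ : ℝ, 0 ≤ κ ∧ ∀ x i, |x i| ≤ κ * N x := by
  obtain ⟨E, _, _, e, he⟩ := exists_normed_model (LinearEquiv.refl ℝ _) hN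
  refine ⟨‖(e.symm : E →L[ℝ] (Fin n → ℝ))‖, norm_nonneg _, fun x i => ?_⟩
  have h := (e.symm : E →L[ℝ] (Fin n → ℝ)).le_opNorm (e x)
  rw [he] at h
  simp only [ContinuousLinearEquiv.coe_coe, ContinuousLinearEquiv.symm_apply_apply] at h
  exact (norm_le_pi_norm x i).trans h

end IsNormFun

/-- A bounded function whose upper bounds `B` self-improve to `a + c * B`, with `c < 1`,
is bounded by `a / (1 - c)`. -/
theorem le_div_one_sub_of_bound_improves {ι : Type*} {S : Set ι} {f : ι → ℝ} {a c b : ℝ}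
    (hc : c < 1) (hb : ∀ x ∈ S, f x ≤ b)
    (h : ∀ B, (∀ x ∈ S, f x ≤ B) → ∀ x ∈ S, f x ≤ a + c * B) {x : ι} (hx : x ∈ S) :
    f x ≤ a / (1 - c) := by
  have hbdd : BddAbove (f '' S) := ⟨b, by rintro _ ⟨y, hy, rfl⟩; exact hb y hy⟩
  have hle : ∀ y ∈ S, f y ≤ sSup (f '' S) := fun y hy => le_csSup hbdd (mem_image_of_mem f hy)
  have hsup : sSup (f '' S) ≤ a + c * sSup (f '' S) :=
    csSup_le ⟨f x, mem_image_of_mem f hx⟩ (by rintro _ ⟨y, hy, rfl⟩; exact h _ hle y hy)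
  refine (hle x hx).trans ?_
  rw [le_div_iff₀ (by linarith)]
  linarith

/-- The assumptions on the right-hand side `H`. -/
structure IsAdmissible {n : ℕ} (N : (Fin n → ℝ) → ℝ) (i : Fin n) (P : Fin n → ℝ) (ε : ℝ)
    (H : Arg n → Fin n → ℝ) (Λ L0 L1 C0 C1 : ℝ) : Prop where
  isNormFun : IsNormFun N
  eps_pos : 0 < ε
  eq_base : P = H (0, 0, 0, P, P)
  time_pos : 0 < Λ
  lip_time : ∀ t' t ζ0 ζ1 ξ0 ξ1,
    (t', ζ0, ζ1, ξ0, ξ1) ∈ nbhd N P ε → (t, ζ0, ζ1, ξ0, ξ1) ∈ nbhd N P ε →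
    N (H (t', ζ0, ζ1, ξ0, ξ1) - H (t, ζ0, ζ1, ξ0, ξ1)) ≤ Λ * |t' - t|
  L0_nonneg : 0 ≤ L0
  L1_nonneg : 0 ≤ L1
  lip_zeta : ∀ t ζ0' ζ1' ζ0 ζ1 ξ0 ξ1,
    (t, ζ0', ζ1', ξ0, ξ1) ∈ nbhd N P ε → (t, ζ0, ζ1, ξ0, ξ1) ∈ nbhd N P ε →
    N (H (t, ζ0', ζ1', ξ0, ξ1) - H (t, ζ0, ζ1, ξ0, ξ1)) ≤
      L0 * N (ζ0' - ζ0) + L1 * N (ζ1' - ζ1)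
  C0_nonneg : 0 ≤ C0
  C1_nonneg : 0 ≤ C1
  contraction : C0 + C1 < 1
  lip_xi : ∀ t ζ0 ζ1 ξ0' ξ1' ξ0 ξ1,
    (t, ζ0, ζ1, ξ0', ξ1') ∈ nbhd N P ε → (t, ζ0, ζ1, ξ0, ξ1) ∈ nbhd N P ε →
    N (H (t, ζ0, ζ1, ξ0', ξ1') - H (t, ζ0, ζ1, ξ0, ξ1)) ≤
      C0 * N (ξ0' - ξ0) + C1 * N (ξ1' - ξ1)
  abs_le_one : ∀ p ∈ nbhd N P ε, |H p i| ≤ 1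

/-- `Z`, with derivative `Z'`, solves the functional differential system on `[-δ, δ]`. -/
structure IsLocalSolution {n : ℕ} (N : (Fin n → ℝ) → ℝ) (i : Fin n) (P : Fin n → ℝ) (ε : ℝ)
    (H : Arg n → Fin n → ℝ) (δ : ℝ) (Z Z' : ℝ → Fin n → ℝ) : Prop where
  pos : 0 < δ
  hasDerivAt : ∀ t ∈ Icc (-δ) δ, HasDerivAt Z (Z' t) t
  map_zero : Z 0 = 0
  mem_nbhd : ∀ t ∈ Icc (-δ) δ, (t, Z t, Z (Z t i), Z' t, Z' (Z t i)) ∈ nbhd N P ε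
  eq_rhs : ∀ t ∈ Icc (-δ) δ, Z' t = H (t, Z t, Z (Z t i), Z' t, Z' (Z t i))

/-- The cube of points all of whose components lie within `ε / 5` of the base point. -/
structure InCube {n : ℕ} (N : (Fin n → ℝ) → ℝ) (P : Fin n → ℝ) (ε t : ℝ)
    (ζ0 ζ1 ξ0 ξ1 : Fin n → ℝ) : Prop where
  time : |t| ≤ ε / 5
  zeta0 : N ζ0 ≤ ε / 5
  zeta1 : N ζ1 ≤ ε / 5
  xi0 : N (ξ0 - P) ≤ ε / 5
  xi1 : N (ξ1 - P) ≤ ε / 5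

theorem InCube.mem_nbhd {n : ℕ} {N : (Fin n → ℝ) → ℝ} {P : Fin n → ℝ} {ε t : ℝ}
    {ζ0 ζ1 ξ0 ξ1 : Fin n → ℝ} (h : InCube N P ε t ζ0 ζ1 ξ0 ξ1) :
    (t, ζ0, ζ1, ξ0, ξ1) ∈ nbhd N P ε := by
  change |t| + N ζ0 + N ζ1 + N (ξ0 - P) + N (ξ1 - P) ≤ ε
  linarith [h.time, h.zeta0, h.zeta1, h.xi0, h.xi1]

section Estimates

variable {n : ℕ} {N : (Fin n → ℝ) → ℝ} {i : Fin n} {P : Fin n → ℝ} {ε : ℝ}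
  {H : Arg n → Fin n → ℝ} {Λ L0 L1 C0 C1 δ : ℝ} {Z Z' : ℝ → Fin n → ℝ}

theorem IsAdmissible.lipschitz_of_inCube (hH : IsAdmissible N i P ε H Λ L0 L1 C0 C1)
    {t' t : ℝ} {ζ0' ζ1' ξ0' ξ1' ζ0 ζ1 ξ0 ξ1 : Fin n → ℝ}
    (h' : InCube N P ε t' ζ0' ζ1' ξ0' ξ1') (h : InCube N P ε t ζ0 ζ1 ξ0 ξ1) :
    N (H (t', ζ0', ζ1', ξ0', ξ1') - H (t, ζ0, ζ1, ξ0, ξ1)) ≤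
      Λ * |t' - t| + (L0 * N (ζ0' - ζ0) + L1 * N (ζ1' - ζ1)) +
        (C0 * N (ξ0' - ξ0) + C1 * N (ξ1' - ξ1)) := by
  have m₁ : InCube N P ε t ζ0' ζ1' ξ0' ξ1' := ⟨h.time, h'.zeta0, h'.zeta1, h'.xi0, h'.xi1⟩
  have m₂ : InCube N P ε t ζ0 ζ1 ξ0' ξ1' := ⟨h.time, h.zeta0, h.zeta1, h'.xi0, h'.xi1⟩
  have e₁ := hH.lip_time _ _ _ _ _ _ h'.mem_nbhd m₁.mem_nbhd
  have e₂ := hH.lip_zeta _ _ _ _ _ _ _ m₁.mem_nbhd m₂.mem_nbhd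
  have e₃ := hH.lip_xi _ _ _ _ _ _ _ m₂.mem_nbhd h.mem_nbhd
  have s₁ := hH.isNormFun.sub_le (H (t', ζ0', ζ1', ξ0', ξ1')) (H (t, ζ0', ζ1', ξ0', ξ1'))
    (H (t, ζ0, ζ1, ξ0, ξ1))
  have s₂ := hH.isNormFun.sub_le (H (t, ζ0', ζ1', ξ0', ξ1')) (H (t, ζ0, ζ1, ξ0', ξ1'))
    (H (t, ζ0, ζ1, ξ0, ξ1))
  linarith

/-- Comparison of `H` with its value `P` at the base point. -/
theorem IsAdmissible.sub_base_le (hH : IsAdmissible N i P ε H Λ L0 L1 C0 C1)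
    {t : ℝ} {ζ0 ζ1 ξ0 ξ1 : Fin n → ℝ} (h : (t, ζ0, ζ1, ξ0, ξ1) ∈ nbhd N P ε) :
    N (H (t, ζ0, ζ1, ξ0, ξ1) - P) ≤
      Λ * |t| + (L0 * N ζ0 + L1 * N ζ1) + (C0 * N (ξ0 - P) + C1 * N (ξ1 - P)) := by
  have hN := hH.isNormFun
  have hsum : |t| + N ζ0 + N ζ1 + N (ξ0 - P) + N (ξ1 - P) ≤ ε := h
  have := hN.nonneg ζ0
  have := hN.nonneg ζ1
  have := hN.nonneg (ξ0 - P)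
  have := hN.nonneg (ξ1 - P)
  have := abs_nonneg t
  have m₁ : (t, ζ0, ζ1, P, P) ∈ nbhd N P ε := by
    change |t| + N ζ0 + N ζ1 + N (P - P) + N (P - P) ≤ ε
    rw [sub_self, hN.map_zero]
    linarith
  have m₂ : (t, 0, 0, P, P) ∈ nbhd N P ε := by
    change |t| + N 0 + N 0 + N (P - P) + N (P - P) ≤ ε
    rw [sub_self, hN.map_zero]
    linarith
  have m₃ : (0, 0, 0, P, P) ∈ nbhd N P ε := by
    change |(0 : ℝ)| + N 0 + N 0 + N (P - P) + N (P - P) ≤ ε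
    rw [sub_self, hN.map_zero, abs_zero]
    linarith
  have e₁ := hH.lip_xi _ _ _ _ _ _ _ h m₁
  have e₂ := hH.lip_zeta _ _ _ _ _ _ _ m₁ m₂
  have e₃ := hH.lip_time _ _ _ _ _ _ m₂ m₃
  rw [← hH.eq_base] at e₃
  simp only [sub_zero] at e₂ e₃
  have s₁ := hN.sub_le (H (t, ζ0, ζ1, ξ0, ξ1)) (H (t, ζ0, ζ1, P, P)) P
  have s₂ := hN.sub_le (H (t, ζ0, ζ1, P, P)) (H (t, 0, 0, P, P)) P
  linarith

namespace IsLocalSolution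

theorem zero_mem (hZ : IsLocalSolution N i P ε H δ Z Z') : (0 : ℝ) ∈ Icc (-δ) δ :=
  ⟨by linarith [hZ.pos], hZ.pos.le⟩

theorem deriv_sub_le_eps (hH : IsAdmissible N i P ε H Λ L0 L1 C0 C1)
    (hZ : IsLocalSolution N i P ε H δ Z Z') {t : ℝ} (ht : t ∈ Icc (-δ) δ) :
    N (Z' t - P) ≤ ε := by
  have h : |t| + N (Z t) + N (Z (Z t i)) + N (Z' t - P) + N (Z' (Z t i) - P) ≤ ε :=
    hZ.mem_nbhd t ht
  have hN := hH.isNormFun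
  linarith [abs_nonneg t, hN.nonneg (Z t), hN.nonneg (Z (Z t i)), hN.nonneg (Z' (Z t i) - P)]

theorem deriv_le (hH : IsAdmissible N i P ε H Λ L0 L1 C0 C1)
    (hZ : IsLocalSolution N i P ε H δ Z Z') {t : ℝ} (ht : t ∈ Icc (-δ) δ) :
    N (Z' t) ≤ N P + ε := by
  have h := hH.isNormFun.add_le (Z' t - P) P
  rw [sub_add_cancel] at h
  linarith [hZ.deriv_sub_le_eps hH ht]

theorem lipschitz (hH : IsAdmissible N i P ε H Λ L0 L1 C0 C1)
    (hZ : IsLocalSolution N i P ε H δ Z Z') {s t : ℝ} (hs : s ∈ Icc (-δ) δ)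
    (ht : t ∈ Icc (-δ) δ) : N (Z t - Z s) ≤ (N P + ε) * |t - s| :=
  hH.isNormFun.image_sub_le hZ.hasDerivAt (fun _ => hZ.deriv_le hH) hs ht

theorem le_mul_abs (hH : IsAdmissible N i P ε H Λ L0 L1 C0 C1)
    (hZ : IsLocalSolution N i P ε H δ Z Z') {t : ℝ} (ht : t ∈ Icc (-δ) δ) :
    N (Z t) ≤ (N P + ε) * |t| := by
  simpa [hZ.map_zero] using hZ.lipschitz hH hZ.zero_mem ht

theorem delay_lipschitz (hH : IsAdmissible N i P ε H Λ L0 L1 C0 C1)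
    (hZ : IsLocalSolution N i P ε H δ Z Z') {s t : ℝ} (hs : s ∈ Icc (-δ) δ)
    (ht : t ∈ Icc (-δ) δ) : |Z t i - Z s i| ≤ |t - s| := by
  have key := Convex.norm_image_sub_le_of_norm_hasDerivWithin_le
    (f := fun x => Z x i) (f' := fun x => Z' x i) (C := 1)
    (fun x hx => (hasDerivAt_pi.1 (hZ.hasDerivAt x hx) i).hasDerivWithinAt)
    (fun x hx => by
      rw [hZ.eq_rhs x hx]
      exact hH.abs_le_one _ (hZ.mem_nbhd x hx))
    (convex_Icc (-δ) δ) hs ht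
  simpa using key

theorem abs_delay_le (hH : IsAdmissible N i P ε H Λ L0 L1 C0 C1)
    (hZ : IsLocalSolution N i P ε H δ Z Z') {t : ℝ} (ht : t ∈ Icc (-δ) δ) :
    |Z t i| ≤ |t| := by
  simpa [hZ.map_zero] using hZ.delay_lipschitz hH hZ.zero_mem ht

theorem delay_mem (hH : IsAdmissible N i P ε H Λ L0 L1 C0 C1)
    (hZ : IsLocalSolution N i P ε H δ Z Z') {r t : ℝ} (hr : r ≤ δ) (ht : t ∈ Icc (-r) r) :
    Z t i ∈ Icc (-r) r :=
  abs_le.1 ((hZ.abs_delay_le hH ⟨by linarith [ht.1], ht.2.trans hr⟩).trans (abs_le.2 ht))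

theorem le_mul_radius (hH : IsAdmissible N i P ε H Λ L0 L1 C0 C1)
    (hZ : IsLocalSolution N i P ε H δ Z Z') {t : ℝ} (ht : t ∈ Icc (-δ) δ) :
    N (Z t) ≤ (N P + ε) * δ :=
  (hZ.le_mul_abs hH ht).trans (mul_le_mul_of_nonneg_left (abs_le.2 ht)
    (add_nonneg (hH.isNormFun.nonneg P) hH.eps_pos.le))

/-- On a short interval the derivative of a solution is uniformly close to `P`. -/
theorem deriv_sub_le (hH : IsAdmissible N i P ε H Λ L0 L1 C0 C1)
    (hZ : IsLocalSolution N i P ε H δ Z Z') {t : ℝ} (ht : t ∈ Icc (-δ) δ) :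
    N (Z' t - P) ≤ (Λ + (L0 + L1) * (N P + ε)) * δ / (1 - (C0 + C1)) := by
  refine le_div_one_sub_of_bound_improves (S := Icc (-δ) δ) (f := fun t => N (Z' t - P))
    hH.contraction (fun _ => hZ.deriv_sub_le_eps hH) (fun B hB s hs => ?_) ht
  have hw := hZ.delay_mem hH le_rfl hs
  have h := hH.sub_base_le (hZ.mem_nbhd s hs)
  rw [← hZ.eq_rhs s hs] at h
  have h₁ := mul_le_mul_of_nonneg_left (abs_le.2 hs) hH.time_pos.le
  have h₂ := mul_le_mul_of_nonneg_left (hZ.le_mul_radius hH hs) hH.L0_nonneg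
  have h₃ := mul_le_mul_of_nonneg_left (hZ.le_mul_radius hH hw) hH.L1_nonneg
  have h₄ := mul_le_mul_of_nonneg_left (hB s hs) hH.C0_nonneg
  have h₅ := mul_le_mul_of_nonneg_left (hB _ hw) hH.C1_nonneg
  linarith

theorem inCube (hH : IsAdmissible N i P ε H Λ L0 L1 C0 C1)
    (hZ : IsLocalSolution N i P ε H δ Z Z') (hδ : δ ≤ ε / 5) (hMδ : (N P + ε) * δ ≤ ε / 5)
    (hKδ : (Λ + (L0 + L1) * (N P + ε)) * δ / (1 - (C0 + C1)) ≤ ε / 5)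
    {t : ℝ} (ht : t ∈ Icc (-δ) δ) : InCube N P ε t (Z t) (Z (Z t i)) (Z' t) (Z' (Z t i)) :=
  have hw := hZ.delay_mem hH le_rfl ht
  ⟨(abs_le.2 ht).trans hδ, (hZ.le_mul_radius hH ht).trans hMδ,
    (hZ.le_mul_radius hH hw).trans hMδ, (hZ.deriv_sub_le hH ht).trans hKδ,
    (hZ.deriv_sub_le hH hw).trans hKδ⟩

/-- The derivative of a solution is Lipschitz, with a constant independent of the solution. -/
theorem deriv_lipschitz (hH : IsAdmissible N i P ε H Λ L0 L1 C0 C1)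
    (hZ : IsLocalSolution N i P ε H δ Z Z') (hcube : ∀ t ∈ Icc (-δ) δ,
      InCube N P ε t (Z t) (Z (Z t i)) (Z' t) (Z' (Z t i)))
    {s t : ℝ} (hs : s ∈ Icc (-δ) δ) (ht : t ∈ Icc (-δ) δ) :
    N (Z' t - Z' s) ≤ (Λ + (L0 + L1) * (N P + ε)) / (1 - (C0 + C1)) * |t - s| := by
  have hN := hH.isNormFun
  have hM : 0 ≤ N P + ε := add_nonneg (hN.nonneg P) hH.eps_pos.le
  rw [div_mul_eq_mul_div]
  refine le_div_one_sub_of_bound_improves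
    (S := {p : ℝ × ℝ | p.1 ∈ Icc (-δ) δ ∧ p.2 ∈ Icc (-δ) δ ∧ |p.2 - p.1| ≤ |t - s|})
    (f := fun p => N (Z' p.2 - Z' p.1)) (b := ε + ε) (x := (s, t)) hH.contraction ?_ ?_
    ⟨hs, ht, le_rfl⟩
  · rintro ⟨u, v⟩ ⟨hu, hv, -⟩
    have h := hN.sub_le (Z' v) P (Z' u)
    rw [hN.sub_comm P] at h
    exact h.trans (add_le_add (hZ.deriv_sub_le_eps hH hv) (hZ.deriv_sub_le_eps hH hu))
  · rintro B hB ⟨u, v⟩ ⟨hu, hv, huv⟩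
    simp only at hu hv huv ⊢
    have hwu := hZ.delay_mem hH le_rfl hu
    have hwv := hZ.delay_mem hH le_rfl hv
    have hw := (hZ.delay_lipschitz hH hu hv).trans huv
    have h := hH.lipschitz_of_inCube (hcube v hv) (hcube u hu)
    rw [← hZ.eq_rhs v hv, ← hZ.eq_rhs u hu] at h
    have h₁ := mul_le_mul_of_nonneg_left huv hH.time_pos.le
    have h₂ := mul_le_mul_of_nonneg_left ((hZ.lipschitz hH hu hv).trans
      (mul_le_mul_of_nonneg_left huv hM)) hH.L0_nonneg
    have h₃ := mul_le_mul_of_nonneg_left ((hZ.lipschitz hH hwu hwv).trans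
      (mul_le_mul_of_nonneg_left hw hM)) hH.L1_nonneg
    have h₄ := mul_le_mul_of_nonneg_left (hB (u, v) ⟨hu, hv, huv⟩) hH.C0_nonneg
    have h₅ := mul_le_mul_of_nonneg_left (hB (Z u i, Z v i) ⟨hwu, hwv, hw⟩) hH.C1_nonneg
    simp only at h₄ h₅
    linarith

/-- Two solutions agree on the smaller of their intervals once both lie in the cube, their
derivatives are `Q`-Lipschitz, and the radius makes the comparison estimate a contraction. -/
theorem eq_of_contraction (hH : IsAdmissible N i P ε H Λ L0 L1 C0 C1)
    {δ₁ δ₂ κ Q r : ℝ} {Z₁ Z₁' Z₂ Z₂' : ℝ → Fin n → ℝ}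
    (h₁ : IsLocalSolution N i P ε H δ₁ Z₁ Z₁') (h₂ : IsLocalSolution N i P ε H δ₂ Z₂ Z₂')
    (hκ : ∀ x : Fin n → ℝ, |x i| ≤ κ * N x) (hκ₀ : 0 ≤ κ) (hQ₀ : 0 ≤ Q)
    (hcube₁ : ∀ t ∈ Icc (-δ₁) δ₁, InCube N P ε t (Z₁ t) (Z₁ (Z₁ t i)) (Z₁' t) (Z₁' (Z₁ t i)))
    (hcube₂ : ∀ t ∈ Icc (-δ₂) δ₂, InCube N P ε t (Z₂ t) (Z₂ (Z₂ t i)) (Z₂' t) (Z₂' (Z₂ t i)))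
    (hQ : ∀ s ∈ Icc (-δ₂) δ₂, ∀ t ∈ Icc (-δ₂) δ₂, N (Z₂' t - Z₂' s) ≤ Q * |t - s|)
    (hr₀ : 0 ≤ r) (hr₁ : r ≤ δ₁) (hr₂ : r ≤ δ₂)
    (hc : (L0 + L1 * (1 + (N P + ε) * κ) + C1 * (Q * κ)) * r + (C0 + C1) < 1)
    {t : ℝ} (ht : t ∈ Icc (-r) r) : Z₁ t = Z₂ t := by
  have hN := hH.isNormFun
  have hM : 0 ≤ N P + ε := add_nonneg (hN.nonneg P) hH.eps_pos.le
  have sub₁ : Icc (-r) r ⊆ Icc (-δ₁) δ₁ := Icc_subset_Icc (by linarith) hr₁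
  have sub₂ : Icc (-r) r ⊆ Icc (-δ₂) δ₂ := Icc_subset_Icc (by linarith) hr₂
  have hzero : (0 : ℝ) ∈ Icc (-r) r := ⟨by linarith, hr₀⟩
  have hdiff : ∀ B, (∀ s ∈ Icc (-r) r, N (Z₁' s - Z₂' s) ≤ B) → ∀ s ∈ Icc (-r) r,
      N (Z₁ s - Z₂ s) ≤ B * r := by
    intro B hB s hs
    have h := hN.image_sub_le (f := fun x => Z₁ x - Z₂ x)
      (fun x hx => (h₁.hasDerivAt x (sub₁ hx)).sub (h₂.hasDerivAt x (sub₂ hx))) hB hzero hs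
    simp only [h₁.map_zero, h₂.map_zero, sub_zero] at h
    exact h.trans (mul_le_mul_of_nonneg_left (abs_le.2 hs)
      ((hN.nonneg _).trans (hB 0 hzero)))
  have hderiv : ∀ s ∈ Icc (-r) r, N (Z₁' s - Z₂' s) ≤ 0 := by
    intro s hs
    rw [← zero_div (1 - ((L0 + L1 * (1 + (N P + ε) * κ) + C1 * (Q * κ)) * r + (C0 + C1)))]
    refine le_div_one_sub_of_bound_improves (S := Icc (-r) r)
      (f := fun s => N (Z₁' s - Z₂' s)) (b := ε + ε) hc (fun u hu => ?_) (fun B hB u hu => ?_) hs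
    · have h := hN.sub_le (Z₁' u) P (Z₂' u)
      rw [hN.sub_comm P] at h
      exact h.trans (add_le_add (h₁.deriv_sub_le_eps hH (sub₁ hu))
        (h₂.deriv_sub_le_eps hH (sub₂ hu)))
    · have hw₁ := h₁.delay_mem hH hr₁ hu
      have hw₂ := h₂.delay_mem hH hr₂ hu
      have hD := hdiff B hB u hu
      have hw : |Z₁ u i - Z₂ u i| ≤ κ * (B * r) :=
        (hκ (Z₁ u - Z₂ u)).trans (mul_le_mul_of_nonneg_left hD hκ₀)
      have hval : N (Z₁ (Z₁ u i) - Z₂ (Z₂ u i)) ≤ B * r + (N P + ε) * (κ * (B * r)) :=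
        (hN.sub_le _ (Z₂ (Z₁ u i)) _).trans (add_le_add (hdiff B hB _ hw₁)
          ((h₂.lipschitz hH (sub₂ hw₂) (sub₂ hw₁)).trans (mul_le_mul_of_nonneg_left hw hM)))
      have hder : N (Z₁' (Z₁ u i) - Z₂' (Z₂ u i)) ≤ B + Q * (κ * (B * r)) :=
        (hN.sub_le _ (Z₂' (Z₁ u i)) _).trans (add_le_add (hB _ hw₁)
          ((hQ _ (sub₂ hw₂) _ (sub₂ hw₁)).trans (mul_le_mul_of_nonneg_left hw hQ₀)))
      have h := hH.lipschitz_of_inCube (hcube₁ u (sub₁ hu)) (hcube₂ u (sub₂ hu))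
      rw [← h₁.eq_rhs u (sub₁ hu), ← h₂.eq_rhs u (sub₂ hu), sub_self, abs_zero] at h
      have e₁ := mul_le_mul_of_nonneg_left hD hH.L0_nonneg
      have e₂ := mul_le_mul_of_nonneg_left hval hH.L1_nonneg
      have e₃ := mul_le_mul_of_nonneg_left (hB u hu) hH.C0_nonneg
      have e₄ := mul_le_mul_of_nonneg_left hder hH.C1_nonneg
      linarith
  have h := hdiff 0 hderiv t ht
  rw [zero_mul] at h
  exact sub_eq_zero.1 ((hN.eq_zero_iff _).1 (le_antisymm h (hN.nonneg _)))

end IsLocalSolution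

end Estimates

/-- Finitely many smallness conditions on a radius can be met simultaneously. -/
theorem exists_pos_forall_mul_le {a b c ε η : ℝ} (hε : 0 < ε) (hη : 0 < η) :
    ∃ d : ℝ, 0 < d ∧ ∀ r : ℝ, 0 < r → r ≤ d → r ≤ ε ∧ a * r ≤ ε ∧ b * r ≤ ε ∧ c * r ≤ η := by
  have key : ∀ a ε : ℝ, 0 < ε → 0 < ε / (|a| + 1) ∧
      ∀ r : ℝ, 0 < r → r ≤ ε / (|a| + 1) → a * r ≤ ε := by
    intro a ε hε
    have ha : 0 < |a| + 1 := by positivity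
    refine ⟨by positivity, fun r hr h => ?_⟩
    rw [le_div_iff₀ ha] at h
    nlinarith [le_abs_self a]
  obtain ⟨pa, ha⟩ := key a ε hε
  obtain ⟨pb, hb⟩ := key b ε hε
  obtain ⟨pc, hc⟩ := key c η hη
  refine ⟨min ε (min (ε / (|a| + 1)) (min (ε / (|b| + 1)) (η / (|c| + 1)))),
    lt_min hε (lt_min pa (lt_min pb pc)), fun r hr h => ?_⟩
  simp only [le_min_iff] at h
  exact ⟨h.1, ha r hr h.2.1, hb r hr h.2.2.1, hc r hr h.2.2.2⟩

/-- uniqueness of the local solution with `Z'(0) = P` of the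
functional differential system, under hypotheses (H1)-(H5). -/
theorem fde_local_uniqueness
    (n : ℕ) (hn : 0 < n)
    (N : (Fin n → ℝ) → ℝ)
    (hN0 : ∀ x, 0 ≤ N x)
    (hNdef : ∀ x, N x = 0 ↔ x = 0)
    (hNadd : ∀ x y, N (x + y) ≤ N x + N y)
    (hNsmul : ∀ (c : ℝ) (x), N (c • x) = |c| * N x)
    (P : Fin n → ℝ) (ε : ℝ) (hε : 0 < ε)
    (H : Arg n → (Fin n → ℝ))
    (hHcont : ContinuousOn H (nbhd N P ε))
    -- (H1)
    (hP : P = H (0, 0, 0, P, P))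
    (hp1 : |P ⟨0, hn⟩| ≤ 1)
    -- (H2)
    (Λ : ℝ) (hΛ : 0 < Λ)
    (hLipT : ∀ t' t ζ0 ζ1 ξ0 ξ1,
      (t', ζ0, ζ1, ξ0, ξ1) ∈ nbhd N P ε → (t, ζ0, ζ1, ξ0, ξ1) ∈ nbhd N P ε →
      N (H (t', ζ0, ζ1, ξ0, ξ1) - H (t, ζ0, ζ1, ξ0, ξ1)) ≤ Λ * |t' - t|)
    -- (H3)
    (L0 L1 : ℝ) (hL0 : 0 ≤ L0) (hL1 : 0 ≤ L1)
    (hLipZeta : ∀ t ζ0' ζ1' ζ0 ζ1 ξ0 ξ1,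
      (t, ζ0', ζ1', ξ0, ξ1) ∈ nbhd N P ε → (t, ζ0, ζ1, ξ0, ξ1) ∈ nbhd N P ε →
      N (H (t, ζ0', ζ1', ξ0, ξ1) - H (t, ζ0, ζ1, ξ0, ξ1)) ≤
        L0 * N (ζ0' - ζ0) + L1 * N (ζ1' - ζ1))
    -- (H4)
    (C0 C1 : ℝ) (hC0 : 0 ≤ C0) (hC1 : 0 ≤ C1) (hC : C0 + C1 < 1)
    (hLipXi : ∀ t ζ0 ζ1 ξ0' ξ1' ξ0 ξ1,
      (t, ζ0, ζ1, ξ0', ξ1') ∈ nbhd N P ε → (t, ζ0, ζ1, ξ0, ξ1) ∈ nbhd N P ε →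
      N (H (t, ζ0, ζ1, ξ0', ξ1') - H (t, ζ0, ζ1, ξ0, ξ1)) ≤
        C0 * N (ξ0' - ξ0) + C1 * N (ξ1' - ξ1))
    -- (H5)
    (hH1 : ∀ p ∈ nbhd N P ε, |H p ⟨0, hn⟩| ≤ 1) :
    ∃ δstar : ℝ, 0 < δstar ∧
      ∀ δ₁ δ₂ : ℝ, 0 < δ₁ → δ₁ ≤ δstar → 0 < δ₂ → δ₂ ≤ δstar →
      ∀ Z₁ Z₁' Z₂ Z₂' : ℝ → Fin n → ℝ,
        (∀ t ∈ Icc (-δ₁) δ₁, HasDerivAt Z₁ (Z₁' t) t) →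
        ContinuousOn Z₁' (Icc (-δ₁) δ₁) →
        Z₁ 0 = 0 → Z₁' 0 = P →
        (∀ t ∈ Icc (-δ₁) δ₁,
          (t, Z₁ t, Z₁ (Z₁ t ⟨0, hn⟩), Z₁' t, Z₁' (Z₁ t ⟨0, hn⟩)) ∈ nbhd N P ε ∧
          Z₁' t = H (t, Z₁ t, Z₁ (Z₁ t ⟨0, hn⟩), Z₁' t, Z₁' (Z₁ t ⟨0, hn⟩))) →
        (∀ t ∈ Icc (-δ₂) δ₂, HasDerivAt Z₂ (Z₂' t) t) →
        ContinuousOn Z₂' (Icc (-δ₂) δ₂) →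
        Z₂ 0 = 0 → Z₂' 0 = P →
        (∀ t ∈ Icc (-δ₂) δ₂,
          (t, Z₂ t, Z₂ (Z₂ t ⟨0, hn⟩), Z₂' t, Z₂' (Z₂ t ⟨0, hn⟩)) ∈ nbhd N P ε ∧
          Z₂' t = H (t, Z₂ t, Z₂ (Z₂ t ⟨0, hn⟩), Z₂' t, Z₂' (Z₂ t ⟨0, hn⟩))) →
        ∀ t ∈ Icc (-(min δ₁ δ₂)) (min δ₁ δ₂), Z₁ t = Z₂ t := by
  have hN : IsNormFun N := ⟨hN0, hNdef, hNadd, hNsmul⟩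
  have hH : IsAdmissible N ⟨0, hn⟩ P ε H Λ L0 L1 C0 C1 :=
    ⟨hN, hε, hP, hΛ, hLipT, hL0, hL1, hLipZeta, hC0, hC1, hC, hLipXi, hH1⟩
  obtain ⟨κ, hκ₀, hκ⟩ := hN.exists_abs_apply_le
  set K := Λ + (L0 + L1) * (N P + ε)
  have hM : 0 ≤ N P + ε := add_nonneg (hN0 P) hε.le
  have hQ₀ : 0 ≤ K / (1 - (C0 + C1)) :=
    div_nonneg (add_nonneg hΛ.le (mul_nonneg (add_nonneg hL0 hL1) hM)) (by linarith)
  obtain ⟨d, hd, hsmall⟩ := exists_pos_forall_mul_le (a := N P + ε) (b := K / (1 - (C0 + C1)))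
    (c := L0 + L1 * (1 + (N P + ε) * κ) + C1 * (K / (1 - (C0 + C1)) * κ))
    (show 0 < ε / 5 by linarith) (show 0 < (1 - (C0 + C1)) / 2 by linarith)
  refine ⟨d, hd, ?_⟩
  intro δ₁ δ₂ hδ₁ hd₁ hδ₂ hd₂ Z₁ Z₁' Z₂ Z₂' hder₁ _ hzero₁ _ hsol₁ hder₂ _ hzero₂ _ hsol₂ t ht
  have h₁ : IsLocalSolution N ⟨0, hn⟩ P ε H δ₁ Z₁ Z₁' :=
    ⟨hδ₁, hder₁, hzero₁, fun s hs => (hsol₁ s hs).1, fun s hs => (hsol₁ s hs).2⟩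
  have h₂ : IsLocalSolution N ⟨0, hn⟩ P ε H δ₂ Z₂ Z₂' :=
    ⟨hδ₂, hder₂, hzero₂, fun s hs => (hsol₂ s hs).1, fun s hs => (hsol₂ s hs).2⟩
  obtain ⟨a₁, b₁, c₁, -⟩ := hsmall δ₁ hδ₁ hd₁
  obtain ⟨a₂, b₂, c₂, -⟩ := hsmall δ₂ hδ₂ hd₂
  rw [div_mul_eq_mul_div] at c₁ c₂
  have hr : 0 < min δ₁ δ₂ := lt_min hδ₁ hδ₂
  obtain ⟨-, -, -, hc⟩ := hsmall _ hr ((min_le_left _ _).trans hd₁)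
  have hcube₂ := fun s hs => h₂.inCube hH a₂ b₂ c₂ (t := s) hs
  exact IsLocalSolution.eq_of_contraction hH h₁ h₂ (fun x => hκ x _) hκ₀ hQ₀
    (fun s hs => h₁.inCube hH a₁ b₁ c₁ hs) hcube₂
    (fun s hs u hu => h₂.deriv_lipschitz hH hcube₂ hs hu) hr.le (min_le_left _ _)
    (min_le_right _ _) (by linarith) ht
end
end

section
/- Let n_b > n_r > 1, Δ_r = n_r/(n_r − 1), Δ_b = n_b/(n_b − 1), let ρ₀, d₀ > 0 and k₀ = ρ₀/d₀. Consider the algebraic system for (p₁, p₄) ∈ ℝ²: p₁ = (ρ₀ + (d₀/Δ_r)(Δ_r/n_r + p₄/ρ₀)) / (ρ₀ + (d₀/Δ_b)(Δ_b/n_b + p₄/ρ₀)) with ρ₀ + (d₀/Δ_b)(Δ_b/n_b + p₄/ρ₀) ≠ 0, and p₄ = ρ₀ (p₁ (Δ_b/n_b + p₄/ρ₀) − Δ_r/n_r). Then: (a) this system has a solution if and only if k₀ ≤ (Δ_r − Δ_b)²/(4 Δ_r Δ_b); (b) if k₀ = (Δ_r − Δ_b)²/(4 Δ_r Δ_b)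 it has exactly one solution, with p₁ = −1; (c) if k₀ < (Δ_r − Δ_b)²/(4 Δ_r Δ_b) it has exactly two solutions, given with δ = (Δ_r − Δ_b)² − 4 k₀ Δ_r Δ_b by p₄ = ρ₀(−(Δ_r/n_r + Δ_b/n_b) − √δ)/2, p₁ = (Δ_r − Δ_b − √δ)/(Δ_b − Δ_r − √δ) and p₄' = ρ₀(−(Δ_r/n_r + Δ_b/n_b) + √δ)/2, p₁' = (Δ_r − Δ_b + √δ)/(Δ_b − Δ_r + √δ), and these satisfy 0 < |p₁| < 1 and |p₁'| > 1. -/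
/-!
STATEMENT 18: solvability of the algebraic system `P = H(0; 0, 0; P, P)`
(reduced to its nontrivial components `p₁, p₄`) for the dichromatic
point-source lens problem.
-/

noncomputable section

/-- `Δ(n) = n/(n-1)`. -/
def Delta (n : ℝ) : ℝ := n / (n - 1)

/-- The algebraic system for `(p₁, p₄)`:
`p₁ = (ρ₀ + (d₀/Δ_r)(Δ_r/n_r + p₄/ρ₀)) / (ρ₀ + (d₀/Δ_b)(Δ_b/n_b + p₄/ρ₀))`
(with nonzero denominator) and
`p₄ = ρ₀ (p₁ (Δ_b/n_b + p₄/ρ₀) - Δ_r/n_r)`. -/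
def solvesSystem (n_r n_b ρ₀ d₀ p₁ p₄ : ℝ) : Prop :=
  ρ₀ + d₀ / Delta n_b * (Delta n_b / n_b + p₄ / ρ₀) ≠ 0 ∧
  p₁ = (ρ₀ + d₀ / Delta n_r * (Delta n_r / n_r + p₄ / ρ₀)) /
        (ρ₀ + d₀ / Delta n_b * (Delta n_b / n_b + p₄ / ρ₀)) ∧
  p₄ = ρ₀ * (p₁ * (Delta n_b / n_b + p₄ / ρ₀) - Delta n_r / n_r)

lemma Delta_div_self {n : ℝ} (hn : 1 < n) : Delta n / n = Delta n - 1 := by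
  have h1 : n - 1 ≠ 0 := by linarith
  have h2 : n ≠ 0 := by linarith
  unfold Delta
  field_simp
  ring

lemma one_lt_Delta {n : ℝ} (hn : 1 < n) : 1 < Delta n := by
  unfold Delta
  rw [lt_div_iff₀ (by linarith)]
  linarith

lemma Delta_lt_Delta {m n : ℝ} (hm : 1 < m) (hmn : m < n) : Delta n < Delta m := by
  unfold Delta
  rw [div_lt_div_iff₀ (by linarith) (by linarith)]
  nlinarith

/-- The reduced system in the variable `v = Δ_b/n_b + p₄/ρ₀` amounts to a quadratic equation. -/
lemma reduced_system_iff {A B ρ d : ℝ} (p v : ℝ) (hB : 0 < B) (hBA : B < A) (hρ : 0 < ρ)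
    (hd : 0 < d) :
    (ρ + d / B * v ≠ 0 ∧ p = (ρ + d / A * (v + (A - B))) / (ρ + d / B * v) ∧
      v + (A - B) = p * v) ↔
      v * (v + (A - B)) = -(ρ / d * A * B) ∧ v + (A - B) = p * v := by
  have hA : 0 < A := hB.trans hBA
  have hD : A - B ≠ 0 := by linarith
  have key : (ρ + d / A * (v + (A - B))) * v - (v + (A - B)) * (ρ + d / B * v) =
      -((A - B) * d / (A * B) * (v * (v + (A - B)) + ρ / d * A * B)) := by
    field_simp
    ring
  constructor
  · rintro ⟨hden, hp, hv⟩
    refine ⟨?_, hv⟩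
    rw [eq_div_iff hden] at hp
    have h0 : (A - B) * d / (A * B) * (v * (v + (A - B)) + ρ / d * A * B) = 0 := by
      rw [hv] at hp key ⊢
      linear_combination key + v * hp
    have hc : (A - B) * d / (A * B) ≠ 0 := by positivity
    linarith [(mul_eq_zero.mp h0).resolve_left hc]
  · rintro ⟨hq, hv⟩
    have hk : 0 < ρ / d := by positivity
    have hv0 : v ≠ 0 := by
      rintro rfl
      have : 0 < ρ / d * A * B := by positivity
      linarith
    have hden : ρ + d / B * v ≠ 0 := by
      intro h
      have hvk : v = -(ρ / d * B) := by
        field_simp at h ⊢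
        linarith
      rw [hvk] at hq
      have : ρ / d * B * (ρ / d * B + B) = 0 := by linear_combination hq
      have : 0 < ρ / d * B * (ρ / d * B + B) := by positivity
      linarith
    refine ⟨hden, ?_, hv⟩
    rw [eq_div_iff hden]
    apply mul_right_cancel₀ hv0
    rw [hq] at key
    linear_combination -key - (ρ + d / B * v) * hv

lemma solvesSystem_iff {n_r n_b ρ₀ d₀ : ℝ} (p₁ p₄ : ℝ) (hr : 1 < n_r) (hrb : n_r < n_b)
    (hρ₀ : 0 < ρ₀) (hd₀ : 0 < d₀) :
    solvesSystem n_r n_b ρ₀ d₀ p₁ p₄ ↔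
      (2 * (p₄ / ρ₀) + (Delta n_r / n_r + Delta n_b / n_b)) ^ 2 =
          (Delta n_r - Delta n_b) ^ 2 - 4 * (ρ₀ / d₀) * Delta n_r * Delta n_b ∧
        Delta n_r / n_r + p₄ / ρ₀ = p₁ * (Delta n_b / n_b + p₄ / ρ₀) := by
  have hB := one_lt_Delta (hr.trans hrb)
  have hlt := Delta_lt_Delta hr hrb
  unfold solvesSystem
  rw [Delta_div_self hr, Delta_div_self (hr.trans hrb)]
  generalize Delta n_r = A at *
  generalize Delta n_b = B at *
  have h4 : p₄ = ρ₀ * (p₁ * (B - 1 + p₄ / ρ₀) - (A - 1)) ↔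
      p₄ / ρ₀ = p₁ * (B - 1 + p₄ / ρ₀) - (A - 1) := by
    rw [div_eq_iff hρ₀.ne', mul_comm ρ₀]
  rw [h4]
  generalize p₄ / ρ₀ = x
  have hu : A - 1 + x = B - 1 + x + (A - B) := by ring
  have h5 : x = p₁ * (B - 1 + x) - (A - 1) ↔ B - 1 + x + (A - B) = p₁ * (B - 1 + x) := by
    constructor <;> intro h <;> linarith
  rw [h5, hu, reduced_system_iff _ _ (by linarith) hlt hρ₀ hd₀]
  refine and_congr_left fun _ => ?_
  constructor <;> intro h
  · linear_combination 4 * h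
  · linear_combination h / 4

/-- Each root `s` of the discriminant gives one solution of the system. -/
lemma solvesSystem_iff_of_sq {n_r n_b ρ₀ d₀ s : ℝ} (p₁ p₄ : ℝ) (hr : 1 < n_r) (hrb : n_r < n_b)
    (hρ₀ : 0 < ρ₀) (hd₀ : 0 < d₀)
    (hs : s ^ 2 = (Delta n_r - Delta n_b) ^ 2 - 4 * (ρ₀ / d₀) * Delta n_r * Delta n_b) :
    solvesSystem n_r n_b ρ₀ d₀ p₁ p₄ ↔
      (p₁ = (Delta n_r - Delta n_b - s) / (Delta n_b - Delta n_r - s) ∧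
          p₄ = ρ₀ * (-(Delta n_r / n_r + Delta n_b / n_b) - s) / 2) ∨
        (p₁ = (Delta n_r - Delta n_b + s) / (Delta n_b - Delta n_r + s) ∧
          p₄ = ρ₀ * (-(Delta n_r / n_r + Delta n_b / n_b) + s) / 2) := by
  rw [solvesSystem_iff p₁ p₄ hr hrb hρ₀ hd₀, ← hs, sq_eq_sq_iff_eq_or_eq_neg, or_and_right,
    or_comm, Delta_div_self hr, Delta_div_self (hr.trans hrb)]
  have hB := one_lt_Delta (hr.trans hrb)
  have hlt := Delta_lt_Delta hr hrb
  generalize Delta n_r = A at *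
  generalize Delta n_b = B at *
  have hpos : 0 < ρ₀ / d₀ * A * B := by
    have : 0 < A := by linarith
    positivity
  have branch (t : ℝ) (ht : t ^ 2 = s ^ 2) :
      2 * (p₄ / ρ₀) + (A - 1 + (B - 1)) = t ∧ A - 1 + p₄ / ρ₀ = p₁ * (B - 1 + p₄ / ρ₀) ↔
        p₁ = (A - B + t) / (B - A + t) ∧ p₄ = ρ₀ * (-(A - 1 + (B - 1)) + t) / 2 := by
    have hne : B - A + t ≠ 0 := by
      intro h
      have : t = A - B := by linarith
      rw [this] at ht
      linarith
    have h4 : p₄ = ρ₀ * (-(A - 1 + (B - 1)) + t) / 2 ↔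
        p₄ / ρ₀ = (-(A - 1 + (B - 1)) + t) / 2 := by
      rw [div_eq_iff hρ₀.ne', mul_comm ρ₀, mul_div_right_comm]
    rw [h4, eq_div_iff hne]
    constructor
    · rintro ⟨h, h'⟩
      have hx : p₄ / ρ₀ = (-(A - 1 + (B - 1)) + t) / 2 := by linarith
      rw [hx] at h'
      exact ⟨by linear_combination -2 * h', hx⟩
    · rintro ⟨h, hx⟩
      rw [hx]
      exact ⟨by ring, by linear_combination -h / 2⟩
  rw [branch s rfl, branch (-s) (by ring)]
  simp only [← sub_eq_add_neg]

theorem algebraic_system_solvability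
    (n_r n_b ρ₀ d₀ k₀ : ℝ) (hr : 1 < n_r) (hrb : n_r < n_b)
    (hρ₀ : 0 < ρ₀) (hd₀ : 0 < d₀) (hk₀ : k₀ = ρ₀ / d₀) :
    -- (a)
    ((∃ p₁ p₄ : ℝ, solvesSystem n_r n_b ρ₀ d₀ p₁ p₄) ↔
      k₀ ≤ (Delta n_r - Delta n_b) ^ 2 / (4 * Delta n_r * Delta n_b)) ∧
    -- (b)
    (k₀ = (Delta n_r - Delta n_b) ^ 2 / (4 * Delta n_r * Delta n_b) →
      ∀ p₁ p₄ : ℝ, solvesSystem n_r n_b ρ₀ d₀ p₁ p₄ ↔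
        (p₁ = -1 ∧
         p₄ = ρ₀ * (-(Delta n_r / n_r + Delta n_b / n_b)) / 2)) ∧
    -- (c)
    (k₀ < (Delta n_r - Delta n_b) ^ 2 / (4 * Delta n_r * Delta n_b) →
      (∀ p₁ p₄ : ℝ, solvesSystem n_r n_b ρ₀ d₀ p₁ p₄ ↔
        ((p₁ = (Delta n_r - Delta n_b -
                  Real.sqrt ((Delta n_r - Delta n_b) ^ 2 - 4 * k₀ * Delta n_r * Delta n_b)) /
                (Delta n_b - Delta n_r -
                  Real.sqrt ((Delta n_r - Delta n_b) ^ 2 - 4 * k₀ * Delta n_r * Delta n_b)) ∧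
          p₄ = ρ₀ * (-(Delta n_r / n_r + Delta n_b / n_b) -
                  Real.sqrt ((Delta n_r - Delta n_b) ^ 2 - 4 * k₀ * Delta n_r * Delta n_b)) / 2) ∨
         (p₁ = (Delta n_r - Delta n_b +
                  Real.sqrt ((Delta n_r - Delta n_b) ^ 2 - 4 * k₀ * Delta n_r * Delta n_b)) /
                (Delta n_b - Delta n_r +
                  Real.sqrt ((Delta n_r - Delta n_b) ^ 2 - 4 * k₀ * Delta n_r * Delta n_b)) ∧
          p₄ = ρ₀ * (-(Delta n_r / n_r + Delta n_b / n_b) +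
                  Real.sqrt ((Delta n_r - Delta n_b) ^ 2 - 4 * k₀ * Delta n_r * Delta n_b)) / 2))) ∧
      0 < |(Delta n_r - Delta n_b -
              Real.sqrt ((Delta n_r - Delta n_b) ^ 2 - 4 * k₀ * Delta n_r * Delta n_b)) /
            (Delta n_b - Delta n_r -
              Real.sqrt ((Delta n_r - Delta n_b) ^ 2 - 4 * k₀ * Delta n_r * Delta n_b))| ∧
      |(Delta n_r - Delta n_b -
          Real.sqrt ((Delta n_r - Delta n_b) ^ 2 - 4 * k₀ * Delta n_r * Delta n_b)) /
        (Delta n_b - Delta n_r -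
          Real.sqrt ((Delta n_r - Delta n_b) ^ 2 - 4 * k₀ * Delta n_r * Delta n_b))| < 1 ∧
      1 < |(Delta n_r - Delta n_b +
              Real.sqrt ((Delta n_r - Delta n_b) ^ 2 - 4 * k₀ * Delta n_r * Delta n_b)) /
            (Delta n_b - Delta n_r +
              Real.sqrt ((Delta n_r - Delta n_b) ^ 2 - 4 * k₀ * Delta n_r * Delta n_b))|) := by
  have hB := one_lt_Delta (hr.trans hrb)
  have hlt := Delta_lt_Delta hr hrb
  have hA : 0 < Delta n_r := by linarith
  have hB0 : 0 < Delta n_b := by linarith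
  have hk : 0 < k₀ := hk₀ ▸ div_pos hρ₀ hd₀
  have hpos : 0 < k₀ * Delta n_r * Delta n_b := by positivity
  have hAB : 0 < 4 * Delta n_r * Delta n_b := by positivity
  refine ⟨⟨?_, ?_⟩, ?_, ?_⟩
  · rintro ⟨p₁, p₄, h⟩
    rw [solvesSystem_iff p₁ p₄ hr hrb hρ₀ hd₀, ← hk₀] at h
    rw [le_div_iff₀ hAB]
    linarith [sq_nonneg (2 * (p₄ / ρ₀) + (Delta n_r / n_r + Delta n_b / n_b)), h.1]
  · intro h
    rw [le_div_iff₀ hAB] at h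
    have hs := Real.sq_sqrt (show 0 ≤ (Delta n_r - Delta n_b) ^ 2 -
      4 * k₀ * Delta n_r * Delta n_b by linarith)
    rw [hk₀] at hs
    exact ⟨_, _, (solvesSystem_iff_of_sq _ _ hr hrb hρ₀ hd₀ hs).2 (Or.inl ⟨rfl, rfl⟩)⟩
  · intro h p₁ p₄
    rw [eq_div_iff hAB.ne'] at h
    have hs : (0 : ℝ) ^ 2 = (Delta n_r - Delta n_b) ^ 2 -
        4 * (ρ₀ / d₀) * Delta n_r * Delta n_b := by
      rw [← hk₀]
      linarith
    have hone : (Delta n_r - Delta n_b) / (Delta n_b - Delta n_r) = -1 := by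
      rw [div_eq_iff (by linarith)]
      ring
    rw [solvesSystem_iff_of_sq p₁ p₄ hr hrb hρ₀ hd₀ hs]
    simp only [sub_zero, add_zero, or_self, hone]
  · intro h
    rw [lt_div_iff₀ hAB] at h
    have hδ : 0 < (Delta n_r - Delta n_b) ^ 2 - 4 * k₀ * Delta n_r * Delta n_b := by linarith
    have hs := Real.sq_sqrt hδ.le
    have hs0 := Real.sqrt_pos.2 hδ
    generalize Real.sqrt ((Delta n_r - Delta n_b) ^ 2 -
      4 * k₀ * Delta n_r * Delta n_b) = s at hs hs0 ⊢
    have hsD : s < Delta n_r - Delta n_b := by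
      apply lt_of_pow_lt_pow_left₀ 2 (by linarith)
      linarith
    have hnum : |Delta n_r - Delta n_b - s| = Delta n_r - Delta n_b - s :=
      abs_of_pos (by linarith)
    have hden : |Delta n_b - Delta n_r - s| = Delta n_r - Delta n_b + s := by
      rw [abs_of_neg (by linarith)]
      ring
    have hnum' : |Delta n_r - Delta n_b + s| = Delta n_r - Delta n_b + s :=
      abs_of_pos (by linarith)
    have hden' : |Delta n_b - Delta n_r + s| = Delta n_r - Delta n_b - s := by
      rw [abs_of_neg (by linarith)]
      ring
    rw [abs_div, abs_div, hnum, hden, hnum', hden']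
    refine ⟨fun p₁ p₄ => solvesSystem_iff_of_sq p₁ p₄ hr hrb hρ₀ hd₀ (hk₀ ▸ hs), ?_, ?_, ?_⟩
    · exact div_pos (by linarith) (by linarith)
    · rw [div_lt_one (by linarith)]
      linarith
    · rw [one_lt_div (by linarith)]
      linarith
end
end
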